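/- arXiv:1607.08875 — 2 statements merged into one kernel-verified Lean document; each statement's English description precedes it below -/
import Mathlib

section
/- Let E ∈ C³(ℝ^N) and let x* be a non-degenerate index-1 saddle, i.e. ∇E(x*) = 0 and λ1(x*) < 0 < λ2(x*) ≤ … ≤ λN(x*). Then the Jacobian of the ISD vector field at x* equals ∇F_ISD(x*) = −(I − 2 v1(x*) ⊗ v1(x*)) ∇²E(x*), which is a symmetric negative definite matrix; consequently x* is an exponentially stable equilibrium of the ISD: there exist r, K, c > 0 such that every solution of the ISD with ‖x(0) − x*‖ < r exists globally and satisfies ‖x(t) − x*‖ ≤ K e^{−ct} for all t ≥ 0. -/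
open Real Filter Set
open scoped Topology RealInnerProductSpace

noncomputable section
abbrev Vec (N : ℕ) := EuclideanSpace ℝ (Fin N)

noncomputable def hessCLM {N : ℕ} (E : Vec N → ℝ) (x : Vec N) : Vec N →L[ℝ] Vec N :=
  fderiv ℝ (gradient E) x

noncomputable def hessOp {N : ℕ} (E : Vec N → ℝ) (x : Vec N) : Module.End ℝ (Vec N) :=
  (hessCLM E x).toLinearMap

def IsMinEigen {N : ℕ} (T : Module.End ℝ (Vec N)) (lam : ℝ) : Prop :=
  T.HasEigenvalue lam ∧ ∀ μ : ℝ, T.HasEigenvalue μ → lam ≤ μ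

def IsMinEigvec {N : ℕ} (T : Module.End ℝ (Vec N)) (w : Vec N) : Prop :=
  ‖w‖ = 1 ∧ ∃ lam : ℝ, IsMinEigen T lam ∧ T w = lam • w

def TwoSmallestEigen {N : ℕ} (T : Module.End ℝ (Vec N)) (lam1 lam2 : ℝ) : Prop :=
  T.HasEigenvalue lam1 ∧ T.HasEigenvalue lam2 ∧ lam1 ≤ lam2 ∧
    (∀ μ : ℝ, T.HasEigenvalue μ → lam1 ≤ μ) ∧
    (∀ μ : ℝ, T.HasEigenvalue μ → μ = lam1 ∨ lam2 ≤ μ) ∧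
    (lam1 < lam2 → Module.finrank ℝ (T.eigenspace lam1) = 1)

/-- the reflection `(I - 2 w ⊗ w) u`. -/
def reflect {N : ℕ} (w u : Vec N) : Vec N := u - (2 * ⟪w, u⟫) • w

/-- ISD vector field with eigendirection `w`. -/
noncomputable def isdField {N : ℕ} (E : Vec N → ℝ) (x w : Vec N) : Vec N :=
  -(reflect w (gradient E x))

def IsISDSolOn {N : ℕ} (E : Vec N → ℝ) (x : ℝ → Vec N) (s : Set ℝ) : Prop :=
  ∀ t ∈ s, ∃ w : Vec N, IsMinEigvec (hessOp E (x t)) w ∧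
    HasDerivAt x (isdField E (x t) w) t

noncomputable def gadVField {N : ℕ} (E : Vec N → ℝ) (x v : Vec N) : Vec N :=
  -(hessCLM E x v) + ⟪v, hessCLM E x v⟫ • v

def IsGADSolOn {N : ℕ} (E : Vec N → ℝ) (ε : ℝ) (x v : ℝ → Vec N) (s : Set ℝ) : Prop :=
  ∀ t ∈ s, ‖v t‖ = 1 ∧ HasDerivAt x (-(reflect (v t) (gradient E (x t)))) t ∧
    HasDerivAt v ((ε ^ 2)⁻¹ • gadVField E (x t) (v t)) t

def IsIndexOneSaddle {N : ℕ} (E : Vec N → ℝ) (x : Vec N) : Prop :=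
  gradient E x = 0 ∧ ∃ lam1 lam2 : ℝ,
    TwoSmallestEigen (hessOp E x) lam1 lam2 ∧ lam1 < 0 ∧ 0 < lam2

end


theorem contDiff_grad {N : ℕ} (E : Vec N → ℝ) (hE : ContDiff ℝ 3 E) :
    ContDiff ℝ 2 (gradient E) := by
  have hg : gradient E = fun y => (InnerProductSpace.toDual ℝ (Vec N)).symm (fderiv ℝ E y) := rfl
  rw [hg]
  exact (InnerProductSpace.toDual ℝ (Vec N)).symm.toContinuousLinearEquiv.contDiff.comp
    (hE.fderiv_right (m := 2) (by norm_num))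

theorem sym_hess {N : ℕ} (E : Vec N → ℝ) (hE : ContDiff ℝ 3 E) (x u w : Vec N) :
    ⟪hessCLM E x u, w⟫ = ⟪u, hessCLM E x w⟫ := by
  have hd : Differentiable ℝ (fderiv ℝ E) :=
    (hE.fderiv_right (m := 1) (by norm_num)).differentiable (by norm_num)
  have hgd : HasFDerivAt (gradient E) (hessCLM E x) x :=
    ((contDiff_grad E hE).differentiable (by norm_num) x).hasFDerivAt
  have key : ∀ a b : Vec N, ⟪hessCLM E x a, b⟫ = fderiv ℝ (fderiv ℝ E) x a b := by
    intro a b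
    have h1 := hgd.inner ℝ (hasFDerivAt_const b x)
    have h2 := (hd x).hasFDerivAt.clm_apply (hasFDerivAt_const b x)
    have h3 : (fun y => ⟪gradient E y, b⟫) = fun y => fderiv ℝ E y b := by
      funext y; exact inner_gradient_left
    rw [h3] at h1
    have := congrArg (fun L => L a) (h1.unique h2)
    simpa using this
  rw [key, real_inner_comm, key]
  exact second_derivative_symmetric (fun y => ((hE.differentiable (by norm_num)) y).hasFDerivAt)
    (hd x).hasFDerivAt u w

theorem contDiff_hess {N : ℕ} (E : Vec N → ℝ) (hE : ContDiff ℝ 3 E) :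
    ContDiff ℝ 1 (hessCLM E) :=
  (contDiff_grad E hE).fderiv_right (m := 1) (by norm_num)

theorem quad_lower {N : ℕ} (A : Module.End ℝ (Vec N)) (hA : A.IsSymmetric) (mu : ℝ) (u : Vec N)
    (h : ∀ (lam : ℝ) (b : Vec N), A.HasEigenvalue lam → A b = lam • b → ⟪b, u⟫ ≠ 0 → mu ≤ lam) :
    mu * ‖u‖ ^ 2 ≤ ⟪A u, u⟫ := by
  have hn : Module.finrank ℝ (Vec N) = N := by simp
  set b := hA.eigenvectorBasis hn with hb
  have e1 : ∀ i, ⟪A u, b i⟫ = hA.eigenvalues hn i * ⟪b i, u⟫ := by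
    intro i
    rw [hA u (b i), hA.apply_eigenvectorBasis hn i, real_inner_comm]
    simp [inner_smul_left, hb]
  have e2 : ⟪A u, u⟫ = ∑ i, hA.eigenvalues hn i * ⟪b i, u⟫ ^ 2 := by
    rw [← b.sum_inner_mul_inner (A u) u]
    refine Finset.sum_congr rfl fun i _ => ?_
    rw [e1]; ring
  have e3 : ‖u‖ ^ 2 = ∑ i, ⟪b i, u⟫ ^ 2 := by
    rw [← real_inner_self_eq_norm_sq, ← b.sum_inner_mul_inner u u]
    refine Finset.sum_congr rfl fun i _ => ?_
    rw [real_inner_comm]; ring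
  rw [e2, e3, Finset.mul_sum]
  refine Finset.sum_le_sum fun i _ => ?_
  by_cases h0 : ⟪b i, u⟫ = 0
  · simp [h0]
  · have := h (hA.eigenvalues hn i) (b i) (hA.hasEigenvalue_eigenvalues hn i)
      (hA.apply_eigenvectorBasis hn i) h0
    gcongr

theorem exists_minEigvec {N : ℕ} (hN : 0 < N) (A : Module.End ℝ (Vec N)) (hA : A.IsSymmetric) :
    ∃ w, IsMinEigvec A w := by
  have hn : Module.finrank ℝ (Vec N) = N := by simp
  have : Nonempty (Fin N) := ⟨⟨0, hN⟩⟩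
  obtain ⟨i, hi⟩ := Finite.exists_min (hA.eigenvalues hn)
  refine ⟨hA.eigenvectorBasis hn i, (hA.eigenvectorBasis hn).orthonormal.1 i,
    hA.eigenvalues hn i, ⟨hA.hasEigenvalue_eigenvalues hn i, ?_⟩, hA.apply_eigenvectorBasis hn i⟩
  intro μ hμ
  obtain ⟨j, hj⟩ := hA.exists_eigenvalues_eq hn hμ
  have := hi j
  have hj' : hA.eigenvalues hn j = μ := by simpa using hj
  linarith

theorem quad_gap {N : ℕ} (A : Module.End ℝ (Vec N)) (hA : A.IsSymmetric) (lam1 lam2 : ℝ)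
    (hts : TwoSmallestEigen A lam1 lam2) (hlt : lam1 < lam2) (v : Vec N) (hv : ‖v‖ = 1)
    (hAv : A v = lam1 • v) (u : Vec N) (hu : ⟪v, u⟫ = 0) : lam2 * ‖u‖ ^ 2 ≤ ⟪A u, u⟫ := by
  refine quad_lower A hA lam2 u fun lam b hl hb hbu => ?_
  obtain ⟨-, -, -, -, h5, h6⟩ := hts
  rcases h5 lam hl with h | h
  · exfalso
    have hf := h6 hlt
    have hv0 : v ≠ 0 := by intro h; simp [h] at hv
    have hvm : v ∈ A.eigenspace lam1 := Module.End.mem_eigenspace_iff.2 hAv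
    have hbm : b ∈ A.eigenspace lam1 := Module.End.mem_eigenspace_iff.2 (h ▸ hb)
    obtain ⟨c, hc⟩ := (finrank_eq_one_iff_of_nonzero' (⟨v, hvm⟩ : A.eigenspace lam1)
      (by simpa [Subtype.ext_iff] using hv0)).1 hf ⟨b, hbm⟩
    have hc' : c • v = b := congrArg Subtype.val hc
    apply hbu
    rw [← hc', inner_smul_left, hu]; simp
  · exact h

theorem minEigvec_lam {N : ℕ} {A : Module.End ℝ (Vec N)} {lam1 lam2 : ℝ}
    (hts : TwoSmallestEigen A lam1 lam2) {v : Vec N} (hv : IsMinEigvec A v) :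
    ‖v‖ = 1 ∧ A v = lam1 • v := by
  obtain ⟨hn, lam, ⟨h1, h2⟩, h3⟩ := hv
  have : lam = lam1 := le_antisymm (h2 _ hts.1) (hts.2.2.2.1 _ h1)
  exact ⟨hn, this ▸ h3⟩

theorem neg_minEigvec {N : ℕ} {A : Module.End ℝ (Vec N)} {v : Vec N} (hv : IsMinEigvec A v) :
    IsMinEigvec A (-v) := by
  obtain ⟨hn, lam, h, h3⟩ := hv
  exact ⟨by simpa using hn, lam, h, by simp [h3]⟩

/-- Davis-Kahan type estimate. -/
theorem davis_kahan {N : ℕ} (A B : Vec N →L[ℝ] Vec N) (a μ β : ℝ) (v w : Vec N) (hv : ‖v‖ = 1) (hw : ‖w‖ = 1) (hAv : A v = a • v)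
    (hBw : B w = β • w) (hgap : ∀ u, ⟪v, u⟫ = 0 → μ * ‖u‖ ^ 2 ≤ ⟪A u, u⟫) (hβ : β < μ)
    (hpos : 0 ≤ ⟪v, w⟫) :
    (μ - β) * ‖w - v‖ ≤ 2 * ‖A - B‖ := by
  set s := ⟪v, w⟫ with hs
  set u := w - s • v with hu
  have hvv : ⟪v, v⟫ = 1 := by rw [real_inner_self_eq_norm_sq, hv]; norm_num
  have hww : ⟪w, w⟫ = 1 := by rw [real_inner_self_eq_norm_sq, hw]; norm_num
  have hvu : ⟪v, u⟫ = 0 := by simp [hu, inner_sub_right, inner_smul_right, hv, ← hs]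
  have hwu : w = u + s • v := by simp [hu]
  have huu : ‖u‖ ^ 2 = 1 - s ^ 2 := by
    rw [← real_inner_self_eq_norm_sq]
    have : ⟪w, v⟫ = s := by rw [real_inner_comm]
    simp only [hu, inner_sub_left, inner_sub_right, inner_smul_left, inner_smul_right, this, ← hs,
      hvv, hww]
    simp; ring
  have hAu : ⟪A u, u⟫ - β * ‖u‖ ^ 2 = ⟪(A - B) w, u⟫ := by
    have h1 : (A - B) w = A u + (s * a) • v - β • (u + s • v) := by
      rw [← hwu, sub_apply, hBw]
      conv_lhs => rw [hwu]
      simp only [map_add, map_smul, hAv, smul_smul]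
      rw [← hwu]
    rw [h1, ← real_inner_self_eq_norm_sq]
    simp only [inner_sub_left, inner_add_left, inner_smul_left, hvu]
    simp
  have hle : ⟪(A - B) w, u⟫ ≤ ‖A - B‖ * ‖u‖ := by
    refine (real_inner_le_norm _ _).trans ?_
    have := (A - B).le_opNorm w
    rw [hw, mul_one] at this
    gcongr
  have h2 : (μ - β) * ‖u‖ ≤ ‖A - B‖ := by
    by_cases h0 : ‖u‖ = 0
    · rw [h0]; simp
    · have hp : 0 < ‖u‖ := lt_of_le_of_ne (norm_nonneg _) (Ne.symm h0)
      have := hgap u hvu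
      refine le_of_mul_le_mul_right ?_ hp
      nlinarith
  have h3 : ‖w - v‖ ≤ 2 * ‖u‖ := by
    have : ‖w - v‖ ^ 2 = 2 - 2 * s := by
      rw [norm_sub_sq_real, hv, hw, real_inner_comm, ← hs]; ring
    have hs1 : s ≤ 1 := by
      have := real_inner_le_norm v w
      rw [hv, hw] at this; linarith
    refine abs_le_of_sq_le_sq' ?_ (by positivity) |>.2
    rw [this, mul_pow, huu]
    nlinarith
  nlinarith [norm_nonneg (w - v)]

theorem reflect_neg {N : ℕ} (w u : Vec N) : reflect (-w) u = reflect w u := by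
  simp [reflect]

theorem reflect_diff {N : ℕ} (v w g h : Vec N) (hv : ‖v‖ = 1) (hw : ‖w‖ = 1) :
    ‖reflect v g - reflect w h‖ ≤ 3 * ‖g - h‖ + 4 * ‖g‖ * ‖v - w‖ := by
  have e : reflect v g - reflect w h = (g - h) - ((2 * ⟪v, g⟫) • (v - w) + (2 * ⟪v - w, g⟫) • w
      + (2 * ⟪w, g - h⟫) • w) := by
    simp only [reflect, inner_sub_left, inner_sub_right]
    module
  have h1 : ‖(2 * ⟪v, g⟫) • (v - w)‖ ≤ 2 * ‖g‖ * ‖v - w‖ := by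
    have := abs_real_inner_le_norm v g
    rw [hv, one_mul] at this
    rw [norm_smul, norm_mul, Real.norm_eq_abs, Real.norm_eq_abs, abs_two]
    gcongr
  have h2 : ‖(2 * ⟪v - w, g⟫) • w‖ ≤ 2 * ‖g‖ * ‖v - w‖ := by
    have := abs_real_inner_le_norm (v - w) g
    rw [norm_smul, norm_mul, Real.norm_eq_abs, Real.norm_eq_abs, abs_two, hw]
    linarith
  have h3 : ‖(2 * ⟪w, g - h⟫) • w‖ ≤ 2 * ‖g - h‖ := by
    have := abs_real_inner_le_norm w (g - h)
    rw [norm_smul, norm_mul, Real.norm_eq_abs, Real.norm_eq_abs, abs_two, hw]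
    rw [hw] at this
    linarith
  rw [e]
  refine (norm_sub_le _ _).trans ?_
  refine (add_le_add_right ((norm_add_le _ _).trans (add_le_add_left (norm_add_le _ _) _)) _).trans ?_
  linarith

theorem lyap {N : ℕ} (x x' : ℝ → Vec N) (p : Vec N) (ρ c T K : ℝ) (hK : 0 < K) (hKρ : K < ρ)
    (hc : 0 < c) (hx : ∀ t ∈ Ico 0 T, HasDerivAt x (x' t) t)
    (hd : ∀ t ∈ Ico 0 T, ‖x t - p‖ < ρ → ⟪x t - p, x' t⟫ ≤ -c * ‖x t - p‖ ^ 2)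
    (h0 : ‖x 0 - p‖ ≤ K) : ∀ t ∈ Ico 0 T, ‖x t - p‖ ≤ K * Real.exp (-(c / 2) * t) := by
  intro t ht
  have hsub : ∀ s ∈ Icc 0 t, s ∈ Ico 0 T := fun s hs => ⟨hs.1, hs.2.trans_lt ht.2⟩
  have hf : ∀ s ∈ Icc 0 t, HasDerivAt (fun s => ‖x s - p‖ ^ 2) (2 * ⟪x s - p, x' s⟫) s := by
    intro s hs
    exact ((hx s (hsub s hs)).sub_const p).norm_sq
  have hB : ∀ s : ℝ, HasDerivAt (fun s => K ^ 2 * Real.exp (-c * s))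
      (K ^ 2 * (Real.exp (-c * s) * (-c * 1))) s := fun s =>
    (((hasDerivAt_id s).const_mul (-c)).exp).const_mul _
  have := image_le_of_deriv_right_lt_deriv_boundary (f := fun s => ‖x s - p‖ ^ 2)
    (f' := fun s => 2 * ⟪x s - p, x' s⟫) (a := 0) (b := t)
    (fun s hs => (hf s hs).continuousAt.continuousWithinAt)
    (fun s hs => (hf s (Ico_subset_Icc_self hs)).hasDerivWithinAt)
    (B := fun s => K ^ 2 * Real.exp (-c * s)) (B' := fun s => K ^ 2 * (Real.exp (-c * s) * (-c * 1)))
    (by simp only [mul_zero, Real.exp_zero, mul_one]; gcongr) hB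
    (by
      intro s hs he
      have he' : ‖x s - p‖ ^ 2 = K ^ 2 * Real.exp (-c * s) := he
      have hBpos : 0 < K ^ 2 * Real.exp (-c * s) := by positivity
      have hle : Real.exp (-c * s) ≤ 1 := Real.exp_le_one_iff.2 (by nlinarith [hs.1])
      have hlt : ‖x s - p‖ < ρ := by
        refine lt_of_le_of_lt ?_ hKρ
        refine abs_le_of_sq_le_sq' ?_ hK.le |>.2
        rw [he']; nlinarith [sq_nonneg K]
      have := hd s (hsub s (Ico_subset_Icc_self hs)) hlt
      rw [he'] at this
      show 2 * ⟪x s - p, x' s⟫ < _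
      nlinarith)
    (right_mem_Icc.2 ht.1)
  refine abs_le_of_sq_le_sq' ?_ (by positivity) |>.2
  refine this.trans (le_of_eq ?_)
  show K ^ 2 * Real.exp (-c * t) = _
  rw [mul_pow, ← Real.exp_nat_mul]
  congr 2; push_cast; ring

theorem glue {N : ℕ} (f : Vec N → Vec N) (α : Vec N → ℝ → Vec N) (S : Set (Vec N)) (h : ℝ)
    (hh : 0 < h) (h0 : ∀ x ∈ S, α x 0 = x) (hS : ∀ x ∈ S, α x h ∈ S)
    (hd : ∀ x ∈ S, ∀ t ∈ Icc 0 h, HasDerivAt (α x) (f (α x t)) t) (x0 : Vec N) (hx0 : x0 ∈ S) :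
    ∃ x : ℝ → Vec N, x 0 = x0 ∧ ∀ t ∈ Ici (0:ℝ), HasDerivAt x (f (x t)) t := by
  set X : ℕ → Vec N := fun n => (fun y => α y h)^[n] x0 with hX
  have hXS : ∀ n, X n ∈ S := by
    intro n
    induction n with
    | zero => exact hx0
    | succ k ih => simp only [hX, Function.iterate_succ_apply']; exact hS _ ih
  have hXs : ∀ n, X (n + 1) = α (X n) h := fun n => by
    simp only [hX, Function.iterate_succ_apply']
  have hdd : ∀ n : ℕ, ∀ t, n * h ≤ t → t ≤ (n + 1) * h →
      HasDerivAt (fun s => α (X n) (s - n * h)) (f (α (X n) (t - n * h))) t := by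
    intro n t h1 h2
    exact HasDerivAt.comp_sub_const t (n * h) (hd (X n) (hXS n) (t - n * h) ⟨by linarith, by linarith⟩)
  set x : ℝ → Vec N := fun t => α (X ⌊t / h⌋₊) (t - ⌊t / h⌋₊ * h) with hx
  -- x equals the n-th piece
  have hp : ∀ n : ℕ, ∀ t, n * h ≤ t → t < (n + 1) * h → x t = α (X n) (t - n * h) := by
    intro n t h1 h2
    have : ⌊t / h⌋₊ = n := by
      have h3 : (0:ℝ) ≤ n * h := by positivity
      rw [Nat.floor_eq_iff (div_nonneg (by linarith) hh.le), le_div_iff₀ hh, div_lt_iff₀ hh]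
      exact ⟨h1, h2⟩
    simp only [hx, this]
  have hneg : ∀ t, t < h → x t = α (X 0) (t - (0:ℕ) * h) := by
    intro t h1
    have : ⌊t / h⌋₊ = 0 := by
      rw [Nat.floor_eq_zero, div_lt_one hh]; exact h1
    simp only [hx, this]
  refine ⟨x, ?_, ?_⟩
  · rw [hneg 0 hh]; simpa [hX] using h0 x0 hx0
  intro t ht
  have ht0 : (0:ℝ) ≤ t := ht
  obtain ⟨n, hn1, hn2⟩ : ∃ n : ℕ, n * h ≤ t ∧ t < (n + 1) * h := by
    refine ⟨⌊t / h⌋₊, ?_, ?_⟩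
    · rw [← le_div_iff₀ hh]; exact Nat.floor_le (by positivity)
    · rw [← div_lt_iff₀ hh]; exact Nat.lt_floor_add_one _
  have hxt := hp n t hn1 hn2
  have hR : HasDerivWithinAt x (f (x t)) (Ici t) t := by
    rw [hxt]
    refine ((hdd n t hn1 hn2.le).hasDerivWithinAt).congr_of_eventuallyEq ?_ hxt
    filter_upwards [self_mem_nhdsWithin, mem_nhdsWithin_of_mem_nhds (Iio_mem_nhds hn2)] with s h1 h2
    exact hp n s (hn1.trans h1) h2
  have hL : HasDerivWithinAt x (f (x t)) (Iic t) t := by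
    rcases hn1.lt_or_eq with hlt | heq
    · rw [hxt]
      refine ((hdd n t hn1 hn2.le).hasDerivWithinAt).congr_of_eventuallyEq ?_ hxt
      filter_upwards [self_mem_nhdsWithin, mem_nhdsWithin_of_mem_nhds (Ioi_mem_nhds hlt)] with s h1 h2
      exact hp n s (le_of_lt h2) (lt_of_le_of_lt h1 hn2)
    · cases n with
      | zero =>
        rw [hxt]
        refine ((hdd 0 t hn1 hn2.le).hasDerivWithinAt).congr_of_eventuallyEq ?_ hxt
        filter_upwards [self_mem_nhdsWithin] with s h1
        refine hneg s (lt_of_le_of_lt h1 ?_)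
        simpa using hn2
      | succ m =>
        have hmt : (m:ℝ) * h < t := by rw [← heq]; push_cast; nlinarith
        have ht2 : t = (m + 1) * h := by rw [← heq]; push_cast; ring
        have hxt' : x t = α (X m) (t - m * h) := by
          rw [hxt, heq, sub_self, h0 _ (hXS _), hXs, ht2]
          congr 1; ring
        rw [hxt']
        refine ((hdd m t hmt.le ht2.le).hasDerivWithinAt).congr_of_eventuallyEq ?_ hxt'
        filter_upwards [self_mem_nhdsWithin, mem_nhdsWithin_of_mem_nhds (Ioi_mem_nhds hmt)]
          with s h1 h2
        rcases (show s ≤ t from h1).lt_or_eq with h3 | h3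
        · exact hp m s (le_of_lt h2) (by rw [← ht2]; exact h3)
        · rw [h3]; exact hxt'
  have := hL.union hR
  rwa [Iic_union_Ici, hasDerivWithinAt_univ] at this

/-- Global solutions for a field Lipschitz near an attracting rest point. -/
theorem global_sol {N : ℕ} (f : Vec N → Vec N) (p : Vec N) (ρ c : ℝ) (K : NNReal) (hρ : 0 < ρ)
    (hc : 0 < c) (hp : f p = 0) (hL : LipschitzOnWith K f (Metric.closedBall p ρ))
    (hd : ∀ x, ‖x - p‖ < ρ → ⟪x - p, f x⟫ ≤ -c * ‖x - p‖ ^ 2) (x0 : Vec N)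
    (hx0 : ‖x0 - p‖ ≤ ρ / 2) :
    ∃ x : ℝ → Vec N, x 0 = x0 ∧ ∀ t ∈ Ici (0:ℝ), HasDerivAt x (f (x t)) t := by
  lift ρ to NNReal using hρ.le
  have hρ' : (0:ℝ) < ρ := hρ
  set τ : ℝ := 1 / (2 * (K + 1)) with hτ
  have hKnn : (0:ℝ) ≤ K := K.2
  have hτ0 : 0 < τ := by positivity
  have hpl : IsPicardLindelof (fun _ => f) (tmin := -τ) (tmax := τ) ⟨0, by constructor <;> linarith⟩
      p ρ (ρ / 2) (K * ρ) K := by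
    refine IsPicardLindelof.of_time_independent ?_ hL ?_
    · intro x hx
      have := hL.dist_le_mul x hx p (Metric.mem_closedBall_self hρ'.le)
      rw [hp, dist_zero_right] at this
      refine this.trans ?_
      push_cast
      gcongr
      exact hx
    · push_cast
      simp only [sub_zero, zero_sub, neg_neg, max_self]
      have : (K:ℝ) * τ ≤ 1 / 2 := by
        rw [hτ, mul_one_div, div_le_div_iff₀ (by positivity) (by norm_num)]; linarith
      nlinarith
  obtain ⟨α, hα⟩ := hpl.exists_forall_mem_closedBall_eq_forall_mem_Icc_hasDerivWithinAt
  have hmem : ∀ x ∈ Metric.closedBall p ((ρ:ℝ) / 2), x ∈ Metric.closedBall p ((ρ / 2 : NNReal) : ℝ) := by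
    intro x hx; simpa using hx
  have hda : ∀ x ∈ Metric.closedBall p ((ρ:ℝ) / 2), ∀ t ∈ Ico (0:ℝ) τ,
      HasDerivAt (α x) (f (α x t)) t := fun x hx t ht =>
    ((hα x (hmem x hx)).2 t ⟨by linarith [ht.1], ht.2.le⟩).hasDerivAt
      (Icc_mem_nhds (by linarith [ht.1]) ht.2)
  have h00 : ∀ x ∈ Metric.closedBall p ((ρ:ℝ) / 2), α x 0 = x := fun x hx => (hα x (hmem x hx)).1
  refine glue f α (Metric.closedBall p ((ρ:ℝ) / 2)) (τ / 2) (by linarith) h00 ?_ ?_ x0 ?_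
  · intro x hx
    have := lyap (α x) (fun t => f (α x t)) p ρ c τ (ρ / 2) (by linarith) (by linarith) hc
      (hda x hx) (fun t _ h => hd _ h)
      (by rw [h00 x hx]; simpa [dist_eq_norm] using hx) (τ / 2) ⟨by linarith, by linarith⟩
    rw [Metric.mem_closedBall, dist_eq_norm]
    refine this.trans ?_
    have : Real.exp (-(c / 2) * (τ / 2)) ≤ 1 := Real.exp_le_one_iff.2 (by nlinarith [mul_pos hc hτ0])
    nlinarith
  · intro x hx t ht
    exact hda x hx t ⟨ht.1, by linarith [ht.2]⟩
  · simpa [dist_eq_norm] using hx0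

theorem inner_le_op {N : ℕ} (A B : Vec N →L[ℝ] Vec N) (u : Vec N) :
    |⟪A u, u⟫ - ⟪B u, u⟫| ≤ ‖A - B‖ * ‖u‖ ^ 2 := by
  rw [← inner_sub_left, ← sub_apply]
  refine (abs_real_inner_le_norm _ _).trans ?_
  have := (A - B).le_opNorm u
  nlinarith [norm_nonneg u]

theorem quad_split {N : ℕ} (A : Vec N →L[ℝ] Vec N) (hA : ∀ u w, ⟪A u, w⟫ = ⟪u, A w⟫)
    (lam1 lam2 : ℝ) (v : Vec N) (hv : ‖v‖ = 1) (hAv : A v = lam1 • v)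
    (hgap : ∀ u, ⟪v, u⟫ = 0 → lam2 * ‖u‖ ^ 2 ≤ ⟪A u, u⟫) (u : Vec N) :
    lam2 * ‖u‖ ^ 2 - (lam2 - lam1) * ⟪v, u⟫ ^ 2 ≤ ⟪A u, u⟫ := by
  set s := ⟪v, u⟫ with hs
  have hvv : ⟪v, v⟫ = 1 := by rw [real_inner_self_eq_norm_sq, hv]; norm_num
  have h0 : ⟪v, u - s • v⟫ = 0 := by
    simp [inner_sub_right, inner_smul_right, hv, ← hs]
  have h1 := hgap _ h0
  have huv : ⟪u, v⟫ = s := by rw [real_inner_comm]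
  have e1 : ‖u - s • v‖ ^ 2 = ‖u‖ ^ 2 - s ^ 2 := by
    rw [← real_inner_self_eq_norm_sq, ← real_inner_self_eq_norm_sq]
    simp only [inner_sub_left, inner_sub_right, inner_smul_left, inner_smul_right, huv, ← hs, hvv]
    simp; ring
  have e2 : ⟪A (u - s • v), u - s • v⟫ = ⟪A u, u⟫ - lam1 * s ^ 2 := by
    have : ⟪A u, v⟫ = lam1 * s := by rw [hA, hAv, inner_smul_right, huv]
    simp only [map_sub, map_smul, hAv, inner_sub_left, inner_sub_right, inner_smul_left,
      inner_smul_right, this, ← hs, hvv]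
    simp; ring
  rw [e1, e2] at h1
  linarith

theorem near_spec {N : ℕ} (A B : Vec N →L[ℝ] Vec N) (hA : ∀ u w, ⟪A u, w⟫ = ⟪u, A w⟫)
    (hB : ∀ u w, ⟪B u, w⟫ = ⟪u, B w⟫)
    (lam1 lam2 : ℝ) (hlt : lam1 < lam2) (v : Vec N) (hv : ‖v‖ = 1) (hAv : A v = lam1 • v)
    (hgap : ∀ u, ⟪v, u⟫ = 0 → lam2 * ‖u‖ ^ 2 ≤ ⟪A u, u⟫)
    (hAB : ‖A - B‖ ≤ (lam2 - lam1) / 8) (w : Vec N) (hw : IsMinEigvec B.toLinearMap w) :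
    ∃ β, B w = β • w ∧ β ≤ lam1 + (lam2 - lam1) / 8 ∧
      (∀ u, ⟪w, u⟫ = 0 → (lam2 - (lam2 - lam1) / 4) * ‖u‖ ^ 2 ≤ ⟪B u, u⟫) ∧
      (0 ≤ ⟪v, w⟫ → (lam2 - lam1) * ‖w - v‖ ≤ 4 * ‖A - B‖) := by
  wlog hpos : 0 ≤ ⟪v, w⟫ generalizing w
  · obtain ⟨β, h1, h2, h3, -⟩ := this (-w) (neg_minEigvec hw)
      (by rw [inner_neg_right]; linarith)
    refine ⟨β, ?_, h2, ?_, fun h => absurd h hpos⟩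
    · simpa using h1
    · intro u hu; exact h3 u (by rw [inner_neg_left, hu, neg_zero])
  obtain ⟨hw1, β, ⟨hβ1, hβ2⟩, hBw⟩ := hw
  have hBw' : B w = β • w := hBw
  have hβ : β ≤ lam1 + (lam2 - lam1) / 8 := by
    have h1 : β * ‖v‖ ^ 2 ≤ ⟪B v, v⟫ :=
      quad_lower B.toLinearMap (fun a b => hB a b) β v (fun l b hl _ _ => hβ2 l hl)
    have h2 := (abs_le.1 (inner_le_op A B v)).1
    have h3 : ⟪A v, v⟫ = lam1 := by
      rw [hAv, inner_smul_left, real_inner_self_eq_norm_sq, hv]; simp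
    rw [hv] at h1 h2
    linarith
  have hDK := davis_kahan A B lam1 lam2 β v w hv hw1 hAv hBw' hgap (by linarith) hpos
  have hn := norm_nonneg (w - v)
  refine ⟨β, hBw', hβ, ?_, fun _ => ?_⟩
  · intro u hu
    have hη : ‖w - v‖ ≤ 2 / 7 := by
      have : (7 / 8 * (lam2 - lam1)) * ‖w - v‖ ≤ (7 / 8 * (lam2 - lam1)) * (2 / 7) := by nlinarith
      exact le_of_mul_le_mul_left this (by linarith)
    have hvu : ⟪v, u⟫ ^ 2 ≤ (2 / 7) ^ 2 * ‖u‖ ^ 2 := by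
      have e : ⟪v, u⟫ = -⟪w - v, u⟫ := by rw [inner_sub_left, hu]; ring
      have := abs_real_inner_le_norm (w - v) u
      rw [e, neg_sq, ← sq_abs, ← mul_pow]
      gcongr
      exact this.trans (by gcongr)
    have hq := quad_split A hA lam1 lam2 v hv hAv hgap u
    have hd := (abs_le.1 (inner_le_op A B u)).2
    have hu2 := sq_nonneg ‖u‖
    have m1 : (lam2 - lam1) * ⟪v, u⟫ ^ 2 ≤ (lam2 - lam1) * ((2 / 7) ^ 2 * ‖u‖ ^ 2) :=
      mul_le_mul_of_nonneg_left hvu (by linarith)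
    have m2 : ‖A - B‖ * ‖u‖ ^ 2 ≤ (lam2 - lam1) / 8 * ‖u‖ ^ 2 :=
      mul_le_mul_of_nonneg_right hAB hu2
    have m3 : 0 ≤ (lam2 - lam1) * ‖u‖ ^ 2 := mul_nonneg (by linarith) hu2
    nlinarith
  · nlinarith

/-- Lipschitz dependence of the field, for two nearby points. -/
theorem field_lip {N : ℕ} (A B C : Vec N →L[ℝ] Vec N) (hA : ∀ u w, ⟪A u, w⟫ = ⟪u, A w⟫)
    (hB : ∀ u w, ⟪B u, w⟫ = ⟪u, B w⟫) (hC : ∀ u w, ⟪C u, w⟫ = ⟪u, C w⟫)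
    (lam1 lam2 : ℝ) (hlt : lam1 < lam2) (v : Vec N) (hv : ‖v‖ = 1) (hAv : A v = lam1 • v)
    (hgap : ∀ u, ⟪v, u⟫ = 0 → lam2 * ‖u‖ ^ 2 ≤ ⟪A u, u⟫)
    (hAB : ‖A - B‖ ≤ (lam2 - lam1) / 8) (hAC : ‖A - C‖ ≤ (lam2 - lam1) / 8)
    (w z : Vec N) (hw : IsMinEigvec B.toLinearMap w) (hz : IsMinEigvec C.toLinearMap z)
    (g h : Vec N) :
    ‖reflect w g - reflect z h‖ ≤ 3 * ‖g - h‖ + 16 / (lam2 - lam1) * ‖g‖ * ‖B - C‖ := by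
  wlog hpos : 0 ≤ ⟪w, z⟫ generalizing z
  · rw [← reflect_neg z]
    exact this (-z) (neg_minEigvec hz) (by rw [inner_neg_right]; linarith)
  obtain ⟨β, b1, b2, b3, -⟩ := near_spec A B hA hB lam1 lam2 hlt v hv hAv hgap hAB w hw
  obtain ⟨γ, c1, c2, c3, -⟩ := near_spec A C hA hC lam1 lam2 hlt v hv hAv hgap hAC z hz
  have hDK := davis_kahan B C β _ γ w z hw.1 hz.1 b1 c1 b3 (by linarith) hpos
  have hg : 0 < lam2 - lam1 := by linarith
  have hn := norm_nonneg (z - w)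
  have h1 : ‖w - z‖ ≤ 4 / (lam2 - lam1) * ‖B - C‖ := by
    rw [norm_sub_rev, div_mul_eq_mul_div, le_div_iff₀ hg]
    nlinarith
  refine (reflect_diff w z g h hw.1 hz.1).trans ?_
  have : 4 * ‖g‖ * ‖w - z‖ ≤ 4 * ‖g‖ * (4 / (lam2 - lam1) * ‖B - C‖) := by gcongr
  refine (add_le_add_right this _).trans (le_of_eq ?_)
  ring

theorem stmt1_J {N : ℕ} (v : Vec N) (A : Vec N →L[ℝ] Vec N) (u : Vec N) :
    (-((ContinuousLinearMap.id ℝ (Vec N)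
                - 2 • (innerSL ℝ v).smulRight v).comp A)) u = -(reflect v (A u)) := by
  simp [reflect, two_smul, two_mul, add_smul]

theorem J_sym {N : ℕ} (A : Vec N →L[ℝ] Vec N) (hA : ∀ u w, ⟪A u, w⟫ = ⟪u, A w⟫)
    (lam1 : ℝ) (v : Vec N) (hAv : A v = lam1 • v) (u w : Vec N) :
    ⟪-(reflect v (A u)), w⟫ = ⟪u, -(reflect v (A w))⟫ := by
  have h : ∀ u, ⟪v, A u⟫ = lam1 * ⟪v, u⟫ := by
    intro u; rw [← hA, hAv, inner_smul_left]; simp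
  simp only [reflect, inner_neg_left, inner_neg_right, inner_sub_left, inner_sub_right,
    inner_smul_left, inner_smul_right, h, hA u w, real_inner_comm v u]
  simp; ring

theorem J_neg {N : ℕ} (A : Vec N →L[ℝ] Vec N) (hA : ∀ u w, ⟪A u, w⟫ = ⟪u, A w⟫)
    (lam1 lam2 : ℝ) (v : Vec N) (hv : ‖v‖ = 1) (hAv : A v = lam1 • v)
    (hgap : ∀ u, ⟪v, u⟫ = 0 → lam2 * ‖u‖ ^ 2 ≤ ⟪A u, u⟫)  (u : Vec N) :
    ⟪u, -(reflect v (A u))⟫ ≤ - min (-lam1) lam2 * ‖u‖ ^ 2 := by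
  have h : ⟪v, A u⟫ = lam1 * ⟪v, u⟫ := by
    rw [← hA, hAv, inner_smul_left]; simp
  have hq := quad_split A hA lam1 lam2 v hv hAv hgap u
  have hs : ⟪v, u⟫ ^ 2 ≤ ‖u‖ ^ 2 := by
    have := abs_real_inner_le_norm v u
    rw [hv, one_mul] at this
    rw [← sq_abs]; gcongr
  have e : ⟪u, -(reflect v (A u))⟫ = -⟪A u, u⟫ + 2 * lam1 * ⟪v, u⟫ ^ 2 := by
    simp only [reflect, inner_neg_right, inner_sub_right, inner_smul_right, h,
      real_inner_comm v u, real_inner_comm (A u) u]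
    ring
  rw [e]
  have m1 := min_le_left (-lam1) lam2
  have m2 := min_le_right (-lam1) lam2
  have := sq_nonneg ⟪v, u⟫
  nlinarith [mul_nonneg (sub_nonneg.2 hs) (sub_nonneg.2 m2), mul_nonneg this (sub_nonneg.2 m1)]

theorem key_est {N : ℕ} (E : Vec N → ℝ) (hE : ContDiff ℝ 3 E)
    (xstar : Vec N) (hgrad : gradient E xstar = 0) (lam1 lam2 : ℝ)
    (hts : TwoSmallestEigen (hessOp E xstar) lam1 lam2) (hlt : lam1 < lam2) :
    ∃ R > 0, ∃ L : NNReal,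
      (∀ x ∈ Metric.closedBall xstar R, ∀ y ∈ Metric.closedBall xstar R, ∀ w z,
        IsMinEigvec (hessOp E x) w → IsMinEigvec (hessOp E y) z →
        ‖isdField E x w - isdField E y z‖ ≤ L * ‖x - y‖) ∧
      ∀ v, IsMinEigvec (hessOp E xstar) v → ∀ ε > 0, ∃ δ > 0, δ ≤ R ∧ ∀ x, ‖x - xstar‖ < δ →
        ∀ w, IsMinEigvec (hessOp E x) w →
        ‖isdField E x w - (-(reflect v (hessCLM E xstar (x - xstar))))‖ ≤ ε * ‖x - xstar‖ := by
  have hsym := sym_hess E hE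
  have hg : 0 < lam2 - lam1 := by linarith
  have hN : 0 < N := by
    rcases Nat.eq_zero_or_pos N with h | h
    · subst h
      obtain ⟨b, hb⟩ := hts.1.exists_hasEigenvector
      exact absurd (Subsingleton.elim b 0) hb.2
    · exact h
  obtain ⟨v0, hv0⟩ := exists_minEigvec hN (hessOp E xstar) (fun a b => hsym xstar a b)
  obtain ⟨hv1, hv2⟩ := minEigvec_lam hts hv0
  have hgap := quad_gap (hessOp E xstar) (fun a b => hsym xstar a b) lam1 lam2 hts hlt v0 hv1 hv2
  have hcont : Continuous (hessCLM E) := (contDiff_hess E hE).continuous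
  obtain ⟨R, hR, hRb⟩ : ∃ R > 0, ∀ x ∈ Metric.closedBall xstar R,
      ‖hessCLM E xstar - hessCLM E x‖ ≤ (lam2 - lam1) / 8 := by
    obtain ⟨δ, hδ, h⟩ := Metric.continuousAt_iff.1 (hcont.continuousAt (x := xstar))
      ((lam2 - lam1) / 8) (by linarith)
    refine ⟨δ / 2, by linarith, fun x hx => ?_⟩
    have := h (x := x) (lt_of_le_of_lt hx (by linarith))
    rw [dist_comm, dist_eq_norm] at this
    exact this.le
  obtain ⟨Kg, hKg⟩ := ((contDiff_grad E hE).contDiffOn (s := Metric.closedBall xstar R)).exists_lipschitzOnWith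
    (by norm_num) (convex_closedBall _ _) (isCompact_closedBall _ _)
  obtain ⟨KH, hKH⟩ := ((contDiff_hess E hE).contDiffOn (s := Metric.closedBall xstar R)).exists_lipschitzOnWith
    (by norm_num) (convex_closedBall _ _) (isCompact_closedBall _ _)
  have hmem : xstar ∈ Metric.closedBall xstar R := Metric.mem_closedBall_self hR.le
  have hgb : ∀ x ∈ Metric.closedBall xstar R, ‖gradient E x‖ ≤ Kg * ‖x - xstar‖ := by
    intro x hx
    have := hKg.dist_le_mul x hx xstar hmem
    rwa [hgrad, dist_zero_right, dist_eq_norm] at this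
  have hflip : ∀ x ∈ Metric.closedBall xstar R, ∀ y ∈ Metric.closedBall xstar R, ∀ w z,
      IsMinEigvec (hessOp E x) w → IsMinEigvec (hessOp E y) z → ∀ g h : Vec N,
      ‖reflect w g - reflect z h‖ ≤ 3 * ‖g - h‖ + 16 / (lam2 - lam1) * ‖g‖ * ‖hessCLM E x - hessCLM E y‖ :=
    fun x hx y hy w z hw hz g h =>
      field_lip (hessCLM E xstar) (hessCLM E x) (hessCLM E y) (hsym _) (hsym _) (hsym _) lam1 lam2
        hlt v0 hv1 hv2 hgap (hRb x hx) (hRb y hy) w z hw hz g h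
  have hHd : ∀ x ∈ Metric.closedBall xstar R, ∀ y ∈ Metric.closedBall xstar R,
      ‖hessCLM E x - hessCLM E y‖ ≤ KH * ‖x - y‖ := by
    intro x hx y hy
    have := hKH.dist_le_mul x hx y hy
    rwa [dist_eq_norm, dist_eq_norm] at this
  have hneg : ∀ a b : Vec N, ‖-a - -b‖ = ‖a - b‖ := fun a b => by
    rw [← norm_neg]; congr 1; abel
  set M : ℝ := 16 / (lam2 - lam1) with hM
  have hM0 : 0 < M := by positivity
  have hKg0 : (0:ℝ) ≤ Kg := Kg.2
  have hKH0 : (0:ℝ) ≤ KH := KH.2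
  refine ⟨R, hR, ⟨3 * Kg + M * (Kg * R) * KH, by positivity⟩, ?_, ?_⟩
  · intro x hx y hy w z hw hz
    unfold isdField
    rw [hneg]
    refine (hflip x hx y hy w z hw hz _ _).trans ?_
    have h1 := hKg.dist_le_mul x hx y hy
    rw [dist_eq_norm, dist_eq_norm] at h1
    have h2 := hHd x hx y hy
    have h3 : ‖gradient E x‖ ≤ Kg * R := (hgb x hx).trans (by
      gcongr; rw [← dist_eq_norm]; exact hx)
    calc _ ≤ 3 * (Kg * ‖x - y‖) + M * (Kg * R) * (KH * ‖x - y‖) := by gcongr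
      _ = (3 * Kg + M * (Kg * R) * KH) * ‖x - y‖ := by ring
      _ = _ := rfl
  · intro v hv ε hε
    have hder : HasFDerivAt (gradient E) (hessCLM E xstar) xstar :=
      ((contDiff_grad E hE).differentiable (by norm_num) xstar).hasFDerivAt
    have hlo := (hasFDerivAt_iff_isLittleO.1 hder).bound (show 0 < ε / 6 by linarith)
    obtain ⟨δ1, hδ1, hb⟩ := Metric.eventually_nhds_iff.1 hlo
    refine ⟨min (min δ1 R) (ε / (2 * (M * Kg * KH + 1))), by positivity,
      (min_le_left _ _).trans (min_le_right _ _), ?_⟩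
    intro x hx w hw
    have hx1 : ‖x - xstar‖ < δ1 := hx.trans_le ((min_le_left _ _).trans (min_le_left _ _))
    have hxR : x ∈ Metric.closedBall xstar R := by
      rw [Metric.mem_closedBall, dist_eq_norm]
      exact (hx.trans_le ((min_le_left _ _).trans (min_le_right _ _))).le
    have hx3 : ‖x - xstar‖ < ε / (2 * (M * Kg * KH + 1)) := hx.trans_le (min_le_right _ _)
    have h1 := hb (y := x) (by rwa [dist_eq_norm])
    rw [hgrad, sub_zero] at h1
    unfold isdField
    rw [hneg]
    refine (hflip x hxR xstar hmem w v hw hv _ _).trans ?_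
    have h2 := hHd x hxR xstar hmem
    have h3 := hgb x hxR
    have h4 : M * Kg * KH * ‖x - xstar‖ ≤ ε / 2 := by
      rw [lt_div_iff₀ (by positivity)] at hx3
      nlinarith [norm_nonneg (x - xstar)]
    calc _ ≤ 3 * (ε / 6 * ‖x - xstar‖) + M * (Kg * ‖x - xstar‖) * (KH * ‖x - xstar‖) := by gcongr
      _ = ε / 2 * ‖x - xstar‖ + (M * Kg * KH * ‖x - xstar‖) * ‖x - xstar‖ := by ring
      _ ≤ ε / 2 * ‖x - xstar‖ + ε / 2 * ‖x - xstar‖ := by gcongr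
      _ = _ := by ring

/-- At a non-degenerate index-1 saddle `x*`, the Jacobian of the ISD field
is `-(I - 2 v1 ⊗ v1) ∇²E(x*)`, a symmetric negative definite operator, and `x*` is an
exponentially stable equilibrium of the ISD. -/
theorem stmt1 {N : ℕ} (E : Vec N → ℝ) (hE : ContDiff ℝ 3 E)
    (xstar : Vec N) (hgrad : gradient E xstar = 0) (lam1 lam2 : ℝ)
    (hts : TwoSmallestEigen (hessOp E xstar) lam1 lam2)
    (h1 : lam1 < 0) (h2 : 0 < lam2) :
    (∀ v1 : Vec N, IsMinEigvec (hessOp E xstar) v1 →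
      -- the Jacobian of the ISD vector field at `x*` is `-(I - 2 v1 ⊗ v1) ∇²E(x*)` …
      ((∀ (U : Set (Vec N)) (v1f : Vec N → Vec N), IsOpen U → xstar ∈ U →
          (∀ x ∈ U, IsMinEigvec (hessOp E x) (v1f x)) → v1f xstar = v1 →
          HasFDerivAt (fun x => isdField E x (v1f x))
            (-((ContinuousLinearMap.id ℝ (Vec N)
                - 2 • (innerSL ℝ v1).smulRight v1).comp (hessCLM E xstar))) xstar) ∧
        -- … which is symmetric …
        (∀ u w : Vec N,
          ⟪(-((ContinuousLinearMap.id ℝ (Vec N)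
                - 2 • (innerSL ℝ v1).smulRight v1).comp (hessCLM E xstar))) u, w⟫ =
          ⟪u, (-((ContinuousLinearMap.id ℝ (Vec N)
                - 2 • (innerSL ℝ v1).smulRight v1).comp (hessCLM E xstar))) w⟫) ∧
        -- … and negative definite.
        (∀ u : Vec N, u ≠ 0 →
          ⟪u, (-((ContinuousLinearMap.id ℝ (Vec N)
                - 2 • (innerSL ℝ v1).smulRight v1).comp (hessCLM E xstar))) u⟫ < 0))) ∧
    -- exponential stability of `x*` under the ISD
    (∃ r K c : ℝ, 0 < r ∧ 0 < K ∧ 0 < c ∧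
      ∀ x0 : Vec N, ‖x0 - xstar‖ < r →
        (∃ x : ℝ → Vec N, x 0 = x0 ∧ IsISDSolOn E x (Ici 0) ∧
          ∀ t ∈ Ici (0:ℝ), ‖x t - xstar‖ ≤ K * Real.exp (-c * t)) ∧
        (∀ (T : ℝ) (x : ℝ → Vec N), 0 < T → x 0 = x0 → IsISDSolOn E x (Ico 0 T) →
          ∀ t ∈ Ico (0:ℝ) T, ‖x t - xstar‖ ≤ K * Real.exp (-c * t))) := by
  have hlt : lam1 < lam2 := h1.trans h2
  have hsym := sym_hess E hE
  obtain ⟨R, hR, L, hLip, hkey⟩ := key_est E hE xstar hgrad lam1 lam2 hts hlt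
  have hneg : ∀ v, IsMinEigvec (hessOp E xstar) v → ∀ u,
      ⟪u, -(reflect v (hessCLM E xstar u))⟫ ≤ - min (-lam1) lam2 * ‖u‖ ^ 2 := by
    intro v hv u
    obtain ⟨hv1, hv2⟩ := minEigvec_lam hts hv
    exact J_neg (hessCLM E xstar) (hsym _) lam1 lam2 v hv1 hv2
      (quad_gap (hessOp E xstar) (fun a b => hsym xstar a b) lam1 lam2 hts hlt v hv1 hv2) u
  have hm0 : 0 < min (-lam1) lam2 := lt_min (by linarith) h2
  refine ⟨fun v hv => ⟨?_, ?_, ?_⟩, ?_⟩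
  · intro U vf hU hxU hvf hvv
    rw [hasFDerivAt_iff_isLittleO, Asymptotics.isLittleO_iff]
    intro ε hε
    obtain ⟨δ, hδ, -, hb⟩ := hkey v hv ε hε
    have hball : ∀ᶠ x in 𝓝 xstar, ‖x - xstar‖ < δ := by
      have := Metric.ball_mem_nhds xstar hδ
      filter_upwards [this] with x hx
      rwa [Metric.mem_ball, dist_eq_norm] at hx
    filter_upwards [hball, hU.mem_nhds hxU] with x hx hxU'
    have h0 : isdField E xstar (vf xstar) = 0 := by simp [isdField, reflect, hgrad]
    rw [h0, sub_zero, stmt1_J]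
    exact hb x hx (vf x) (hvf x hxU')
  · intro u w
    rw [stmt1_J, stmt1_J]
    exact J_sym _ (hsym _) lam1 v (minEigvec_lam hts hv).2 u w
  · intro u hu
    rw [stmt1_J]
    refine (hneg v hv u).trans_lt ?_
    have : 0 < ‖u‖ := norm_pos_iff.2 hu
    have := mul_pos hm0 (pow_pos this 2)
    linarith
  · have hN : 0 < N := by
      rcases Nat.eq_zero_or_pos N with h | h
      · subst h
        obtain ⟨b, hb⟩ := hts.1.exists_hasEigenvector
        exact absurd (Subsingleton.elim b 0) hb.2
      · exact h
    choose W hW using fun x : Vec N =>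
      exists_minEigvec hN (hessOp E x) (fun a b => hsym x a b)
    set m := min (-lam1) lam2 with hm
    obtain ⟨δ, hδ, hδR, hb⟩ := hkey (W xstar) (hW xstar) (m / 2) (by linarith)
    have hlyap : ∀ x, ‖x - xstar‖ < δ → ∀ w, IsMinEigvec (hessOp E x) w →
        ⟪x - xstar, isdField E x w⟫ ≤ -(m / 2) * ‖x - xstar‖ ^ 2 := by
      intro x hx w hw
      have e1 := hb x hx w hw
      have e2 := hneg (W xstar) (hW xstar) (x - xstar)
      have e3 := real_inner_le_norm (x - xstar)
        (isdField E x w - (-(reflect (W xstar) (hessCLM E xstar (x - xstar)))))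
      rw [inner_sub_right] at e3
      have := mul_le_mul_of_nonneg_left e1 (norm_nonneg (x - xstar))
      nlinarith
    have hstab : ∀ x0 : Vec N, ‖x0 - xstar‖ < δ / 2 →
        ∀ (T : ℝ) (x : ℝ → Vec N), 0 < T → x 0 = x0 → IsISDSolOn E x (Ico 0 T) →
          ∀ t ∈ Ico (0:ℝ) T, ‖x t - xstar‖ ≤ δ / 2 * Real.exp (-(m / 2 / 2) * t) := by
      intro x0 hx0 T x _ hx hsol
      have : ∀ t, ∃ w, t ∈ Ico 0 T → IsMinEigvec (hessOp E (x t)) w ∧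
          HasDerivAt x (isdField E (x t) w) t := by
        intro t
        by_cases ht : t ∈ Ico 0 T
        · obtain ⟨w, hw⟩ := hsol t ht
          exact ⟨w, fun _ => hw⟩
        · exact ⟨0, fun h => absurd h ht⟩
      choose w hw using this
      exact lyap x (fun t => isdField E (x t) (w t)) xstar δ (m / 2) T (δ / 2) (by linarith)
        (by linarith) (by linarith) (fun t ht => (hw t ht).2)
        (fun t ht h => hlyap _ h _ (hw t ht).1) (by rw [hx]; exact hx0.le)
    refine ⟨δ / 2, δ / 2, m / 2 / 2, by linarith, by linarith, by linarith, fun x0 hx0 =>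
      ⟨?_, hstab x0 hx0⟩⟩
    obtain ⟨x, hx, hsol⟩ := global_sol (fun x => isdField E x (W x)) xstar δ (m / 2) L hδ
      (by linarith) (by simp [isdField, reflect, hgrad])
      (LipschitzOnWith.of_dist_le_mul fun a ha b hb' => by
        rw [dist_eq_norm, dist_eq_norm]
        exact hLip a (Metric.closedBall_subset_closedBall hδR ha) b
          (Metric.closedBall_subset_closedBall hδR hb') _ _ (hW a) (hW b))
      (fun x h => hlyap x h _ (hW x)) x0 hx0.le
    have hsol' : IsISDSolOn E x (Ici 0) := fun t ht => ⟨W (x t), hW _, hsol t ht⟩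
    refine ⟨x, hx, hsol', fun t ht => ?_⟩
    have ht0 : (0:ℝ) ≤ t := ht
    exact hstab x0 hx0 (t + 1) x (by linarith) hx (fun s hs => hsol' s hs.1) t ⟨ht0, by linarith⟩
end

section
/- Let E ∈ C³(ℝ^N), L > 0, and let Ω ⊂ ℝ^N be a bounded closed connected component of { x : ‖∇E(x)‖ ≤ L } with λ1(x) < 0 < λ2(x) for all x ∈ Ω. Then there exist ε0, δ0 > 0 such that for all 0 < ε ≤ ε0 and all initial conditions x(0) = x0 ∈ int(Ω), v(0) ∈ S¹ (unit sphere) with ‖v(0) − v1(x0)‖ < δ0 (for a suitable sign of v1(x0)), the ε-GAD admits a unique global solution (x, v) ∈ C¹([0,∞); Ω × S¹), and there exist an index-1 saddle x* ∈ Ω and constants K, c > 0 with ‖x(t) − x*‖ + ‖v(t) − v1(x*)‖ ≤ K e^{−ct} for all t ≥ 0. -/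
open Real Filter Set
open scoped Topology RealInnerProductSpace

section Gen
variable {Z : Type*} [NormedAddCommGroup Z] [NormedSpace ℝ Z]

theorem gad_exists_global [CompleteSpace Z] (F : Z → Z) (K : NNReal) (hK : LipschitzWith K F) (M : ℝ)
    (hM : ∀ z, ‖F z‖ ≤ M) (z0 : Z) : ∃ z : ℝ → Z, z 0 = z0 ∧ ∀ t, HasDerivAt z (F (z t)) t := by
  have hM0 : 0 ≤ M := (norm_nonneg _).trans (hM z0)
  have h1 : ∀ n : ℕ, ∃ α : ℝ → Z, α 0 = z0 ∧
      ∀ t ∈ Ioo (-((n:ℝ)+1)) ((n:ℝ)+1), HasDerivAt α (F (α t)) t := by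
    intro n
    have hn : (0:ℝ) ≤ n := Nat.cast_nonneg n
    have hmem : (0:ℝ) ∈ Icc (-((n:ℝ)+1)) ((n:ℝ)+1) := ⟨by linarith, by linarith⟩
    have hp : IsPicardLindelof (fun _ : ℝ => F) (⟨0, hmem⟩ : Icc (-((n:ℝ)+1)) ((n:ℝ)+1)) z0
        (⟨M * (n+1), by positivity⟩ : NNReal) 0 (⟨M, hM0⟩ : NNReal) K :=
      { lipschitzOnWith := fun t _ => hK.lipschitzOnWith
        continuousOn := fun x _ => continuousOn_const
        norm_le := fun t _ x _ => hM x
        mul_max_le := by simp; exact le_of_eq rfl }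
    obtain ⟨α, ha, hb⟩ := hp.exists_eq_forall_mem_Icc_hasDerivWithinAt₀
    refine ⟨α, ha, fun t ht => (hb t (Ioo_subset_Icc_self ht)).hasDerivAt (Icc_mem_nhds ht.1 ht.2)⟩
  choose α ha hb using h1
  have hu : ∀ (k n : ℕ) (s : ℝ), |s| < k + 1 → |s| < n + 1 → α k s = α n s := by
    intro k n s hk hn
    have hlt : |s| < ((min k n : ℕ):ℝ) + 1 := by
      rcases le_total k n with h | h
      · rwa [min_eq_left h]
      · rwa [min_eq_right h]
    have hsub1 : Ioo (-(((min k n : ℕ):ℝ)+1)) (((min k n : ℕ):ℝ)+1) ⊆ Ioo (-((k:ℝ)+1)) ((k:ℝ)+1) := by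
      have : ((min k n : ℕ):ℝ) ≤ k := by exact_mod_cast min_le_left k n
      exact Ioo_subset_Ioo (by linarith) (by linarith)
    have hsub2 : Ioo (-(((min k n : ℕ):ℝ)+1)) (((min k n : ℕ):ℝ)+1) ⊆ Ioo (-((n:ℝ)+1)) ((n:ℝ)+1) := by
      have : ((min k n : ℕ):ℝ) ≤ n := by exact_mod_cast min_le_right k n
      exact Ioo_subset_Ioo (by linarith) (by linarith)
    have h0 : (0:ℝ) ≤ ((min k n : ℕ):ℝ) := Nat.cast_nonneg _
    exact ODE_solution_unique_of_mem_Ioo (v := fun _ => F) (s := fun _ => univ) (K := K) (t₀ := 0)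
      (fun t _ => hK.lipschitzOnWith) ⟨by linarith, by linarith⟩
      (fun t ht => ⟨hb k t (hsub1 ht), mem_univ _⟩)
      (fun t ht => ⟨hb n t (hsub2 ht), mem_univ _⟩) (by rw [ha, ha]) (abs_lt.1 hlt)
  refine ⟨fun t => α ⌈|t|⌉₊ t, ha _, fun t => ?_⟩
  have hlt : |t| < (⌈|t|⌉₊ : ℝ) + 1 := (Nat.le_ceil _).trans_lt (lt_add_one _)
  refine (hb ⌈|t|⌉₊ t (abs_lt.1 hlt)).congr_of_eventuallyEq ?_
  have : ∀ᶠ s in 𝓝 t, |s| < (⌈|t|⌉₊ : ℝ) + 1 := continuous_abs.continuousAt.eventually_lt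
    continuousAt_const hlt
  filter_upwards [this] with s hs
  exact hu _ _ s ((Nat.le_ceil _).trans_lt (lt_add_one _)) hs

theorem gad_exp_conv [CompleteSpace Z] (z z' : ℝ → Z) (K c : ℝ) (hc : 0 < c)
    (hz : ∀ t, 0 ≤ t → HasDerivAt z (z' t) t)
    (hb : ∀ t, 0 ≤ t → ‖z' t‖ ≤ K * Real.exp (-c * t)) :
    ∃ zs, Tendsto z atTop (𝓝 zs) ∧ ∀ t, 0 ≤ t → ‖z t - zs‖ ≤ K / c * Real.exp (-c * t) := by
  have hK : 0 ≤ K := by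
    have := (norm_nonneg _).trans (hb 0 le_rfl); simpa using this
  have key : ∀ s t, 0 ≤ s → s ≤ t → ‖z t - z s‖ ≤ K / c * Real.exp (-c * s) := by
    intro s t hs hst
    have h := image_norm_le_of_norm_deriv_right_le_deriv_boundary (a := s) (b := t)
      (f := fun u => z u - z s) (f' := z')
      (B := fun u => K / c * (Real.exp (-c * s) - Real.exp (-c * u)))
      (B' := fun u => K * Real.exp (-c * u))
      (fun u hu => ((hz u (hs.trans hu.1)).continuousAt.sub continuousAt_const).continuousWithinAt)
      (fun u hu => ((hz u (hs.trans hu.1)).sub_const _).hasDerivWithinAt)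
      (by simp) (fun u => by
        have h1 : HasDerivAt (fun u : ℝ => -c * u) (-c) u := by
          simpa using (hasDerivAt_id u).const_mul (-c)
        refine ((h1.exp.const_sub (Real.exp (-c * s))).const_mul (K / c)).congr_deriv ?_
        have := hc.ne'
        field_simp)
      (fun u hu => hb u (hs.trans hu.1)) (right_mem_Icc.2 hst)
    refine h.trans ?_
    have : 0 ≤ Real.exp (-c * t) := (Real.exp_pos _).le
    gcongr
    linarith
  have hlim : Tendsto (fun s => K / c * Real.exp (-c * s)) atTop (𝓝 0) := by
    have : Tendsto (fun s : ℝ => -c * s) atTop atBot :=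
      tendsto_id.const_mul_atTop_of_neg (by linarith)
    simpa using (Real.tendsto_exp_atBot.comp this).const_mul (K / c)
  have hcau : CauchySeq z := by
    rw [Metric.cauchySeq_iff']
    intro e he
    obtain ⟨s, hs⟩ := ((hlim.eventually (gt_mem_nhds he)).and (eventually_ge_atTop 0)).exists
    refine ⟨s, fun t ht => ?_⟩
    rw [dist_eq_norm]
    exact (key s t hs.2 ht).trans_lt hs.1
  obtain ⟨zs, hzs⟩ := cauchySeq_tendsto_of_complete hcau
  refine ⟨zs, hzs, fun s hs => ?_⟩
  have h2 : Tendsto (fun t => ‖z t - z s‖) atTop (𝓝 ‖zs - z s‖) := (hzs.sub_const _).norm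
  rw [norm_sub_rev]
  exact le_of_tendsto h2 ((eventually_ge_atTop s).mono fun t ht => key s t hs ht)

theorem gad_unique [FiniteDimensional ℝ Z] (F : Z → Z) (hF : ContDiff ℝ 1 F) (z y : ℝ → Z)
    (hz : ∀ t, 0 ≤ t → HasDerivAt z (F (z t)) t) (hy : ∀ t, 0 ≤ t → HasDerivAt y (F (y t)) t)
    (h0 : z 0 = y 0) : ∀ t, 0 ≤ t → z t = y t := by
  intro T hT
  have cz : ContinuousOn z (Icc 0 T) := fun t ht => (hz t ht.1).continuousAt.continuousWithinAt
  have cy : ContinuousOn y (Icc 0 T) := fun t ht => (hy t ht.1).continuousAt.continuousWithinAt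
  obtain ⟨A, hA⟩ := isCompact_Icc.exists_bound_of_continuousOn cz
  obtain ⟨B, hB⟩ := isCompact_Icc.exists_bound_of_continuousOn cy
  have : ProperSpace Z := FiniteDimensional.proper_real Z
  obtain ⟨K, hK⟩ := (hF.contDiffOn (s := Metric.closedBall (0:Z) (max A B))).exists_lipschitzOnWith
    (by simp) (convex_closedBall _ _) (isCompact_closedBall _ _)
  exact ODE_solution_unique_of_mem_Icc_right (v := fun _ => F)
    (s := fun _ => Metric.closedBall (0:Z) (max A B)) (fun t _ => hK) cz
    (fun t ht => (hz t ht.1).hasDerivWithinAt)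
    (fun t ht => by simpa using Or.inl (hA t (Ico_subset_Icc_self ht))) cy
    (fun t ht => (hy t ht.1).hasDerivWithinAt)
    (fun t ht => by simpa using Or.inr (hB t (Ico_subset_Icc_self ht))) h0 (right_mem_Icc.2 hT)
end Gen

theorem gad_linalg {V : Type*} [NormedAddCommGroup V] [InnerProductSpace ℝ V] (H : V →L[ℝ] V)
    (hs : ∀ u w, ⟪H u, w⟫ = ⟪u, H w⟫) (m Λ l : ℝ) (hm : 0 < m) (hΛ : ‖H‖ ≤ Λ) (w : V)
    (hw : ‖w‖ = 1) (hHw : H w = l • w) (hl : l ≤ -m)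
    (hpos : ∀ z, ⟪w, z⟫ = 0 → m * ‖z‖ ^ 2 ≤ ⟪z, H z⟫) (η : ℝ)
    (hη : (Λ + m) * η ≤ m ^ 3 / 8) (v : V) (hv : ‖v‖ = 1) (hρ : ⟪v, H v⟫ ≤ 0)
    (hq : ‖-(H v) + ⟪v, H v⟫ • v‖ ^ 2 ≤ η) :
    ⟪v, H v⟫ ≤ -(m / 2) ∧ ∀ u, ⟪v, u⟫ = 0 → m / 2 * ‖u‖ ^ 2 ≤ ⟪u, H u⟫ := by
  have hww : ⟪w, w⟫ = 1 := by rw [real_inner_self_eq_norm_sq, hw]; norm_num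
  have hlΛ : -Λ ≤ l := by
    have h := H.le_opNorm w
    rw [hHw, norm_smul, hw, mul_one, mul_one, Real.norm_eq_abs] at h
    have := neg_abs_le l
    linarith
  have hΛ0 : 0 ≤ Λ := (norm_nonneg _).trans hΛ
  -- decomposition
  have dec : ∀ u : V, ∃ b : ℝ, ∃ y : V, u = b • w + y ∧ ⟪w, y⟫ = 0 ∧ ‖u‖ ^ 2 = b ^ 2 + ‖y‖ ^ 2 ∧
      ⟪u, H u⟫ = l * b ^ 2 + ⟪y, H y⟫ := by
    intro u
    refine ⟨⟪w, u⟫, u - ⟪w, u⟫ • w, by abel, ?_, ?_, ?_⟩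
    · rw [inner_sub_right, inner_smul_right, hww]; ring
    · rw [← real_inner_self_eq_norm_sq, ← real_inner_self_eq_norm_sq]
      simp only [inner_sub_left, inner_sub_right, inner_smul_left, inner_smul_right, hww,
        real_inner_comm w u]
      simp; ring
    · have h1 : ⟪w, H u⟫ = l * ⟪w, u⟫ := by
        rw [← hs, hHw, inner_smul_left]; simp
      simp only [map_sub, map_smul, hHw, inner_sub_left, inner_sub_right, inner_smul_left,
        inner_smul_right, hww, h1, real_inner_comm w u]
      simp; ring
  obtain ⟨a, z, hvz, hwz, hvn, hvH⟩ := dec v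
  set ρ := ⟪v, H v⟫ with hρd
  -- bound on z
  have hwHz : ⟪w, H z⟫ = 0 := by rw [← hs, hHw, inner_smul_left, hwz]; simp
  have hz1 : m * ‖z‖ ≤ ‖-(H v) + ρ • v‖ := by
    have h1 : m * ‖z‖ ^ 2 ≤ ⟪z, H v - ρ • v⟫ := by
      have h2 : ⟪z, H v - ρ • v⟫ = ⟪z, H z⟫ - ρ * ‖z‖ ^ 2 := by
        rw [hvz]
        simp only [map_add, map_smul, hHw, inner_sub_right, inner_add_right, inner_smul_right,
          real_inner_comm w z ▸ hwz, real_inner_self_eq_norm_sq]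
        ring
      rw [h2]
      nlinarith [hpos z hwz, sq_nonneg ‖z‖]
    have h3 : ⟪z, H v - ρ • v⟫ ≤ ‖z‖ * ‖-(H v) + ρ • v‖ := by
      refine (real_inner_le_norm _ _).trans_eq ?_
      rw [← norm_neg (H v - ρ • v)]; congr 2; abel
    rcases (norm_nonneg z).eq_or_lt with h | h
    · rw [← h]; simp
    · nlinarith
  have hz2 : m ^ 2 * ‖z‖ ^ 2 ≤ η := by
    refine le_trans ?_ hq
    rw [← mul_pow]
    exact pow_le_pow_left₀ (by positivity) hz1 2
  have hz3 : (Λ + m) * ‖z‖ ^ 2 ≤ m / 8 := by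
    have : m ^ 2 * ((Λ + m) * ‖z‖ ^ 2) ≤ m ^ 2 * (m / 8) := by nlinarith
    exact le_of_mul_le_mul_left this (by positivity)
  rw [hv] at hvn
  have hs8 : ‖z‖ ^ 2 ≤ 1 / 8 := by nlinarith [sq_nonneg ‖z‖]
  have hzH : ⟪z, H z⟫ ≤ Λ * ‖z‖ ^ 2 := by
    have h1 := real_inner_le_norm z (H z)
    have h2 := H.le_opNorm z
    have h3 : ‖H‖ * ‖z‖ ≤ Λ * ‖z‖ := by gcongr
    nlinarith [norm_nonneg z]
  refine ⟨by nlinarith [sq_nonneg a], fun u hu => ?_⟩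
  obtain ⟨b, y, huy, hwy, hun, huH⟩ := dec u
  have hab : a * b = -⟪z, y⟫ := by
    rw [hvz, huy] at hu
    simp only [inner_add_left, inner_add_right, inner_smul_left, inner_smul_right, hww, hwy,
      real_inner_comm w z ▸ hwz] at hu
    simp at hu; linarith
  have hzy : ⟪z, y⟫ ^ 2 ≤ ‖z‖ ^ 2 * ‖y‖ ^ 2 := by
    rw [← mul_pow, ← sq_abs]
    exact pow_le_pow_left₀ (abs_nonneg _) (abs_real_inner_le_norm _ _) 2
  have hb : b ^ 2 ≤ 2 * ‖z‖ ^ 2 * ‖u‖ ^ 2 := by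
    have h1 : a ^ 2 * b ^ 2 ≤ ‖z‖ ^ 2 * ‖y‖ ^ 2 := by
      rw [← mul_pow, hab, neg_sq]; exact hzy
    have h2 : ‖z‖ ^ 2 * ‖y‖ ^ 2 ≤ ‖z‖ ^ 2 * ‖u‖ ^ 2 := by
      refine mul_le_mul_of_nonneg_left ?_ (sq_nonneg _); linarith [sq_nonneg b]
    have h5 : 7 / 8 * b ^ 2 ≤ a ^ 2 * b ^ 2 :=
      mul_le_mul_of_nonneg_right (by linarith) (sq_nonneg _)
    have h6 : 0 ≤ ‖z‖ ^ 2 * ‖u‖ ^ 2 := by positivity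
    linarith
  have h4 : (Λ + m) * b ^ 2 ≤ m / 4 * ‖u‖ ^ 2 := by
    calc (Λ + m) * b ^ 2 ≤ (Λ + m) * (2 * ‖z‖ ^ 2 * ‖u‖ ^ 2) := by gcongr
      _ = 2 * ((Λ + m) * ‖z‖ ^ 2) * ‖u‖ ^ 2 := by ring
      _ ≤ 2 * (m / 8) * ‖u‖ ^ 2 := by gcongr
      _ = _ := by ring
  have h7 : -Λ * b ^ 2 ≤ l * b ^ 2 := mul_le_mul_of_nonneg_right hlΛ (sq_nonneg _)
  have h8 := hpos y hwy
  have h9 : ‖y‖ ^ 2 = ‖u‖ ^ 2 - b ^ 2 := by linarith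
  have h10 : 0 ≤ m * ‖u‖ ^ 2 := by positivity
  rw [h9] at h8
  rw [huH]
  nlinarith

section Hess
variable {N : ℕ}

theorem gad_contDiff_gradient (E : Vec N → ℝ) (hE : ContDiff ℝ 3 E) :
    ContDiff ℝ 2 (gradient E) := by
  have h1 : ContDiff ℝ 2 (fderiv ℝ E) := hE.fderiv_right (by norm_num)
  exact (InnerProductSpace.toDual ℝ (Vec N)).symm.toContinuousLinearEquiv.contDiff.comp h1

theorem gad_contDiff_hess (E : Vec N → ℝ) (hE : ContDiff ℝ 3 E) :
    ContDiff ℝ 1 (hessCLM E) :=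
  (gad_contDiff_gradient E hE).fderiv_right (by norm_num)

theorem gad_hasFDerivAt_gradient (E : Vec N → ℝ) (hE : ContDiff ℝ 3 E) (x : Vec N) :
    HasFDerivAt (gradient E) (hessCLM E x) x :=
  ((gad_contDiff_gradient E hE).differentiable (by norm_num) x).hasFDerivAt

theorem gad_hess_symm (E : Vec N → ℝ) (hE : ContDiff ℝ 3 E) (x u w : Vec N) :
    ⟪hessCLM E x u, w⟫ = ⟪u, hessCLM E x w⟫ := by
  have hd : DifferentiableAt ℝ (fderiv ℝ E) x :=
    (hE.fderiv_right (m := 2) (by norm_num)).differentiable (by norm_num) x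
  have key : ∀ u w : Vec N, ⟪hessCLM E x u, w⟫ = fderiv ℝ (fderiv ℝ E) x u w := by
    intro u w
    have h1 := (((gad_hasFDerivAt_gradient E hE x).inner ℝ (hasFDerivAt_const w x)))
    have h2 := hd.hasFDerivAt.clm_apply (hasFDerivAt_const w x)
    have h3 : (fun y => ⟪gradient E y, w⟫) = fun y => fderiv ℝ E y w := by
      funext y
      exact InnerProductSpace.toDual_symm_apply
    rw [← h3] at h2
    have h4 := congrArg (fun T => T u) (h1.unique h2)
    simpa using h4
  have hsym : IsSymmSndFDerivAt ℝ E x := hE.contDiffAt.isSymmSndFDerivAt (by simp; norm_num)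
  rw [key, hsym.eq, ← key, real_inner_comm]

theorem gad_derivs (E : Vec N → ℝ) (hE : ContDiff ℝ 3 E) (k γ C : ℝ) (hk : 0 < k)
    (x v : ℝ → Vec N) (t : ℝ)
    (hx : HasDerivAt x (-(reflect (v t) (gradient E (x t)))) t)
    (hv : HasDerivAt v (k • gadVField E (x t) (v t)) t) (hv1 : ‖v t‖ = 1)
    (hC : ‖fderiv ℝ (hessCLM E) (x t)‖ ≤ C)
    (hρ : ⟪v t, hessCLM E (x t) (v t)⟫ ≤ -γ)
    (hu : ∀ u, ⟪v t, u⟫ = 0 → γ * ‖u‖ ^ 2 ≤ ⟪u, hessCLM E (x t) u⟫) :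
    ∃ g' q', HasDerivAt (fun s => ‖gradient E (x s)‖ ^ 2) g' t ∧
      HasDerivAt (fun s => ‖gadVField E (x s) (v s)‖ ^ 2) q' t ∧
      g' ≤ -2 * γ * ‖gradient E (x t)‖ ^ 2 ∧
      q' ≤ 6 * C * ‖gradient E (x t)‖ * ‖gadVField E (x t) (v t)‖
        - 4 * γ * k * ‖gadVField E (x t) (v t)‖ ^ 2 := by
  have hvv : ⟪v t, v t⟫ = 1 := by rw [real_inner_self_eq_norm_sq, hv1]; norm_num
  have hG : HasDerivAt (fun s => gradient E (x s)) _ t :=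
    (gad_hasFDerivAt_gradient E hE (x t)).comp_hasDerivAt t hx
  have hHd : HasFDerivAt (hessCLM E) (fderiv ℝ (hessCLM E) (x t)) (x t) :=
    ((gad_contDiff_hess E hE).differentiable (by norm_num) (x t)).hasFDerivAt
  have hH : HasDerivAt (fun s => hessCLM E (x s)) _ t := hHd.comp_hasDerivAt t hx
  have hHv := hH.clm_apply hv
  have hR := hHv.neg.add ((hv.inner ℝ hHv).smul hv)
  have hsy := gad_hess_symm E hE (x t)
  set G := gradient E (x t) with hGd
  set H := hessCLM E (x t) with hHdef
  set w := v t with hwd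
  set R := gadVField E (x t) w with hRd
  set D := fderiv ℝ (hessCLM E) (x t) with hD
  have hRdef : R = -(H w) + ⟪w, H w⟫ • w := rfl
  have hRw : ⟪R, w⟫ = 0 := by
    rw [hRdef, inner_add_left, inner_neg_left, inner_smul_left, hvv, real_inner_comm]; simp
  have hwR : ⟪w, R⟫ = 0 := by rw [real_inner_comm]; exact hRw
  refine ⟨_, _, hG.norm_sq, hR.norm_sq, ?_, ?_⟩
  · set a := ⟪w, G⟫ with ha
    set u := G - a • w with hud
    have hGu : G = u + a • w := by rw [hud]; abel
    have hwu : ⟪w, u⟫ = 0 := by rw [hud, inner_sub_right, inner_smul_right, hvv, ← ha]; ring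
    have huw : ⟪u, w⟫ = 0 := by rw [real_inner_comm]; exact hwu
    have hr : reflect w G = u - a • w := by
      rw [reflect, hud, ← ha]; module
    have e1 : ⟪G, H (-(reflect w G))⟫ = -⟪u, H u⟫ + a ^ 2 * ⟪w, H w⟫ := by
      rw [hr]
      have : ⟪w, H u⟫ = ⟪u, H w⟫ := by rw [← hsy, real_inner_comm]
      conv_lhs => rw [hGu]
      simp only [map_neg, map_sub, map_smul, inner_add_left, inner_neg_right, inner_sub_right,
        inner_smul_left, inner_smul_right, this]
      simp; ring
    have e2 : ‖G‖ ^ 2 = ‖u‖ ^ 2 + a ^ 2 := by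
      conv_lhs => rw [hGu, ← real_inner_self_eq_norm_sq]
      simp only [inner_add_left, inner_add_right, inner_smul_left, inner_smul_right, huw, hwu, hvv,
        real_inner_self_eq_norm_sq]
      simp; ring
    rw [e1, e2]
    have := hu u hwu
    nlinarith [sq_nonneg a]
  · have hxn : ‖-(reflect w G)‖ ≤ 3 * ‖G‖ := by
      rw [norm_neg, reflect]
      refine (norm_sub_le _ _).trans ?_
      rw [norm_smul, hv1, norm_mul]
      have := abs_real_inner_le_norm w G
      rw [hv1] at this
      simp only [Real.norm_eq_abs]
      norm_num
      linarith
    have hD1 : ‖D (-(reflect w G)) w‖ ≤ 3 * C * ‖G‖ := by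
      have h1 := (D (-(reflect w G))).le_opNorm w
      rw [hv1, mul_one] at h1
      refine h1.trans ((D.le_opNorm _).trans ?_)
      calc ‖D‖ * ‖-(reflect w G)‖ ≤ C * (3 * ‖G‖) :=
            mul_le_mul hC hxn (norm_nonneg _) (le_trans (norm_nonneg D) hC)
        _ = _ := by ring
    have hin : -⟪R, D (-(reflect w G)) w⟫ ≤ ‖R‖ * (3 * C * ‖G‖) := by
      rw [← inner_neg_right]
      refine (real_inner_le_norm _ _).trans ?_
      rw [norm_neg]; gcongr
    have hRR := hu R hwR
    have e3 : ⟪R, -(D (-(reflect w G)) w + H (k • R)) +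
        (⟪w, H w⟫ • (k • R) + (⟪w, D (-(reflect w G)) w + H (k • R)⟫ + ⟪k • R, H w⟫) • w)⟫ =
        -⟪R, D (-(reflect w G)) w⟫ - k * ⟪R, H R⟫ + k * ⟪w, H w⟫ * ‖R‖ ^ 2 := by
      simp only [map_smul, inner_add_right, inner_neg_right, inner_smul_right, hRw,
        real_inner_self_eq_norm_sq]
      ring
    refine (mul_le_mul_of_nonneg_left (le_of_eq e3) (by norm_num)).trans ?_
    have h5 : k * (γ * ‖R‖ ^ 2) ≤ k * ⟪R, H R⟫ := by gcongr
    have h6 : k * ‖R‖ ^ 2 * ⟪w, H w⟫ ≤ k * ‖R‖ ^ 2 * -γ := by gcongr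
    nlinarith
end Hess

section Core
variable {N : ℕ}

theorem gad_contDiff_F (E : Vec N → ℝ) (hE : ContDiff ℝ 3 E) (k : ℝ) :
    ContDiff ℝ 1 (fun z : Vec N × Vec N =>
      ((-(reflect z.2 (gradient E z.1)), k • gadVField E z.1 z.2) : Vec N × Vec N)) := by
  have h1 : ContDiff ℝ 1 (fun z : Vec N × Vec N => gradient E z.1) :=
    ((gad_contDiff_gradient E hE).of_le (by norm_num)).comp contDiff_fst
  have h2 : ContDiff ℝ 1 (fun z : Vec N × Vec N => hessCLM E z.1) :=
    (gad_contDiff_hess E hE).comp contDiff_fst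
  have h3 : ContDiff ℝ 1 (fun z : Vec N × Vec N => hessCLM E z.1 z.2) := h2.clm_apply contDiff_snd
  have h4 : ContDiff ℝ 1 (fun z : Vec N × Vec N => z.2) := contDiff_snd
  refine ContDiff.prodMk ?_ ?_
  · exact (h1.sub ((contDiff_const.mul (h4.inner ℝ h1)).smul h4)).neg
  · exact (h3.neg.add ((h4.inner ℝ h3).smul h4)).const_smul k

theorem gad_inner_field (E : Vec N → ℝ) (x v : Vec N) :
    ⟪v, gadVField E x v⟫ = ⟪v, hessCLM E x v⟫ * (‖v‖ ^ 2 - 1) := by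
  rw [gadVField, inner_add_right, inner_neg_right, inner_smul_right, real_inner_self_eq_norm_sq]
  ring

theorem gad_core (E : Vec N → ℝ) (hE : ContDiff ℝ 3 E) (L : ℝ) (Ω : Set (Vec N))
    (hcomp : ∃ y ∈ {x : Vec N | ‖gradient E x‖ ≤ L},
      Ω = connectedComponentIn {x : Vec N | ‖gradient E x‖ ≤ L} y)
    (hclosed : IsClosed Ω) (B : ℝ) (hB : ∀ x ∈ Ω, ‖x‖ ≤ B)
    (η γ C A k : ℝ) (hγ : 0 < γ) (hA : 0 < A) (hk : 1 ≤ k) (hCA : 9 * C ^ 2 ≤ 2 * γ ^ 2 * A * k)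
    (hgood : ∀ x ∈ Ω, ∀ v : Vec N, ‖v‖ = 1 → ⟪v, hessCLM E x v⟫ ≤ 0 →
      ‖gadVField E x v‖ ^ 2 ≤ η → ⟪v, hessCLM E x v⟫ ≤ -γ ∧
        ∀ u, ⟪v, u⟫ = 0 → γ * ‖u‖ ^ 2 ≤ ⟪u, hessCLM E x u⟫)
    (hC : ∀ x ∈ Ω, ‖fderiv ℝ (hessCLM E) x‖ ≤ C)
    (x0 v0 : Vec N) (hx0 : x0 ∈ Ω) (hg0 : ‖gradient E x0‖ < L) (hv0 : ‖v0‖ = 1)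
    (hρ0 : ⟪v0, hessCLM E x0 v0⟫ ≤ 0)
    (hV0 : ‖gadVField E x0 v0‖ ^ 2 + A * ‖gradient E x0‖ ^ 2 < η) :
    ∃ x v : ℝ → Vec N, x 0 = x0 ∧ v 0 = v0 ∧ ContDiff ℝ 1 x ∧ ContDiff ℝ 1 v ∧
      ∀ t, 0 ≤ t → x t ∈ Ω ∧ ‖v t‖ = 1 ∧
        HasDerivAt x (-(reflect (v t) (gradient E (x t)))) t ∧
        HasDerivAt v (k • gadVField E (x t) (v t)) t ∧
        ⟪v t, hessCLM E (x t) (v t)⟫ ≤ -γ ∧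
        ‖gadVField E (x t) (v t)‖ ^ 2 + A * ‖gradient E (x t)‖ ^ 2 ≤ η * Real.exp (-γ * t) := by
  set F : Vec N × Vec N → Vec N × Vec N := fun z =>
      (-(reflect z.2 (gradient E z.1)), k • gadVField E z.1 z.2) with hF
  have hFc : ContDiff ℝ 1 F := gad_contDiff_F E hE k
  let χ : ContDiffBump (0 : Vec N × Vec N) :=
    ⟨max B 1, max B 1 + 1, lt_of_lt_of_le one_pos (le_max_right _ _), lt_add_one _⟩
  have hFt : ContDiff ℝ 1 (fun z => χ z • F z) := χ.contDiff.smul hFc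
  have hcs : HasCompactSupport (fun z => χ z • F z) := χ.hasCompactSupport.smul_right
  obtain ⟨K, hK⟩ := ContDiff.lipschitzWith_of_hasCompactSupport hcs hFt (by norm_num)
  obtain ⟨M, hM⟩ := hcs.exists_bound_of_continuous hFt.continuous
  obtain ⟨z, hz0, hz⟩ := gad_exists_global _ K hK M hM (x0, v0)
  have hzc : Continuous z := continuous_iff_continuousAt.2 fun t => (hz t).continuousAt
  have hzC1 : ContDiff ℝ 1 z := by
    rw [contDiff_one_iff_deriv]
    refine ⟨fun t => (hz t).differentiableAt, ?_⟩
    have : deriv z = fun t => χ (z t) • F (z t) := funext fun t => (hz t).deriv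
    rw [this]
    exact hFt.continuous.comp hzc
  set x : ℝ → Vec N := fun t => (z t).1 with hxd
  set v : ℝ → Vec N := fun t => (z t).2 with hvd
  have hx' : ∀ t, HasDerivAt x (χ (z t) • (-(reflect (v t) (gradient E (x t))))) t :=
    fun t => (ContinuousLinearMap.fst ℝ (Vec N) (Vec N)).hasFDerivAt.comp_hasDerivAt t (hz t)
  have hv' : ∀ t, HasDerivAt v (χ (z t) • (k • gadVField E (x t) (v t))) t :=
    fun t => (ContinuousLinearMap.snd ℝ (Vec N) (Vec N)).hasFDerivAt.comp_hasDerivAt t (hz t)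
  have hx00 : x 0 = x0 := by simp [hxd, hz0]
  have hv00 : v 0 = v0 := by simp [hvd, hz0]
  have cx : Continuous x := continuous_fst.comp hzc
  have cv : Continuous v := continuous_snd.comp hzc
  have cG : Continuous fun t => gradient E (x t) := (gad_contDiff_gradient E hE).continuous.comp cx
  have cH : Continuous fun t => hessCLM E (x t) (v t) :=
    ((gad_contDiff_hess E hE).continuous.comp cx).clm_apply cv
  have cρ : Continuous fun t => ⟪v t, hessCLM E (x t) (v t)⟫ := cv.inner cH
  have cg : Continuous fun t => ‖gradient E (x t)‖ ^ 2 := cG.norm.pow 2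
  have cR : Continuous fun t => gadVField E (x t) (v t) := cH.neg.add (cρ.smul cv)
  -- norm preservation
  have hv1 : ∀ t, 0 ≤ t → ‖v t‖ = 1 := by
    intro T hT
    have cc : Continuous fun t => 2 * (χ (z t) * (k * ⟪v t, hessCLM E (x t) (v t)⟫)) :=
      continuous_const.mul ((χ.continuous.comp hzc).mul (continuous_const.mul cρ))
    obtain ⟨a, ha⟩ := (isCompact_Icc (a := (0:ℝ)) (b := T)).exists_bound_of_continuousOn
      cc.continuousOn
    have h := eq_zero_of_abs_deriv_le_mul_abs_self_of_eq_zero_right (a := 0) (b := T)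
      (f := fun t => ‖v t‖ ^ 2 - 1)
      (f' := fun t => 2 * (χ (z t) * (k * ⟪v t, hessCLM E (x t) (v t)⟫)) * (‖v t‖ ^ 2 - 1))
      (K := a) ((cv.norm.pow 2).sub continuous_const).continuousOn
      (fun t ht => by
        refine (((hv' t).norm_sq.sub_const 1).congr_deriv ?_).hasDerivWithinAt
        rw [inner_smul_right, inner_smul_right, gad_inner_field]; ring)
      (by simp [hv00, hv0])
      (fun t ht => by
        rw [norm_mul]
        exact mul_le_mul_of_nonneg_right (ha t (Ico_subset_Icc_self ht)) (norm_nonneg _))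
      T (right_mem_Icc.2 hT)
    have h2 : ‖v T‖ ^ 2 = 1 := by
      have h3 : ‖v T‖ ^ 2 - 1 = 0 := h
      linarith
    exact (pow_eq_one_iff_of_nonneg (norm_nonneg _) (by norm_num)).1 h2
  have hχ : ∀ t, 0 ≤ t → x t ∈ Ω → χ (z t) = 1 := by
    intro t ht hxt
    apply χ.one_of_mem_closedBall
    rw [mem_closedBall_zero_iff, Prod.norm_def]
    exact max_le ((hB _ hxt).trans (le_max_left _ _)) ((hv1 t ht).le.trans (le_max_right _ _))
  set g : ℝ → ℝ := fun t => ‖gradient E (x t)‖ ^ 2 with hg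
  set q : ℝ → ℝ := fun t => ‖gadVField E (x t) (v t)‖ ^ 2 with hq
  set V : ℝ → ℝ := fun t => q t + A * g t with hV
  have cV : Continuous V := (cR.norm.pow 2).add (continuous_const.mul cg)
  have hqV : ∀ t, q t ≤ V t := fun t => by
    have : 0 ≤ A * g t := by positivity
    simp only [hV]; linarith
  have hder : ∀ t, 0 ≤ t → x t ∈ Ω → ⟪v t, hessCLM E (x t) (v t)⟫ ≤ 0 → V t ≤ η →
      HasDerivAt x (-(reflect (v t) (gradient E (x t)))) t ∧
      HasDerivAt v (k • gadVField E (x t) (v t)) t ∧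
      ⟪v t, hessCLM E (x t) (v t)⟫ ≤ -γ ∧
      ∃ g' V', HasDerivAt g g' t ∧ HasDerivAt V V' t ∧ g' ≤ 0 ∧ V' ≤ -γ * V t := by
    intro t ht hxt hρt hVt
    have h1 := hx' t
    have h2 := hv' t
    rw [hχ t ht hxt, one_smul] at h1 h2
    obtain ⟨h3, h4⟩ := hgood _ hxt _ (hv1 t ht) hρt ((hqV t).trans hVt)
    obtain ⟨g', q', hg', hq', hgl, hql⟩ := gad_derivs E hE k γ C (by linarith) x v t h1 h2
      (hv1 t ht) (hC _ hxt) h3 h4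
    refine ⟨h1, h2, h3, g', q' + A * g', hg', hq'.add (hg'.const_mul A), ?_, ?_⟩
    · refine hgl.trans ?_
      have : 0 ≤ γ * ‖gradient E (x t)‖ ^ 2 := by positivity
      linarith
    · simp only [hV, hq, hg]
      set a := ‖gradient E (x t)‖
      set b := ‖gadVField E (x t) (v t)‖
      have h5 : A * g' ≤ A * (-2 * γ * a ^ 2) := by gcongr
      have h6 : 6 * C * a * b ≤ γ * A * a ^ 2 + 2 * γ * k * b ^ 2 := by
        have hpos : 0 < γ * A := by positivity
        have h7 : γ * A * (6 * C * a * b) ≤ γ * A * (γ * A * a ^ 2 + 2 * γ * k * b ^ 2) := by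
          have h8 : 9 * C ^ 2 * b ^ 2 ≤ 2 * γ ^ 2 * A * k * b ^ 2 := by gcongr
          nlinarith [sq_nonneg (γ * A * a - 3 * C * b)]
        exact le_of_mul_le_mul_left h7 hpos
      have h9 : γ * b ^ 2 ≤ γ * k * b ^ 2 := by
        have : 0 ≤ γ * b ^ 2 := by positivity
        nlinarith
      have h10 : 0 ≤ γ * b ^ 2 := by positivity
      linarith
  have hV00 : V 0 < η := by simp only [hV, hq, hg, hx00, hv00]; exact hV0
  have hL0 : 0 < L := (norm_nonneg _).trans_lt hg0
  have hg00 : g 0 < L ^ 2 := by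
    simp only [hg, hx00]; exact pow_lt_pow_left₀ hg0 (norm_nonneg _) (by norm_num)
  have hVn : ∀ t, 0 ≤ V t := fun t => by simp only [hV, hq, hg]; positivity
  -- bootstrap
  have hboot : ∀ T, 0 ≤ T → T ∈ {t | x t ∈ Ω ∧ ⟪v t, hessCLM E (x t) (v t)⟫ ≤ 0 ∧ V t ≤ V 0 ∧
      g t ≤ g 0} := by
    intro T hT
    refine IsClosed.Icc_subset_of_forall_exists_gt (a := 0) (b := T) ?_ ?_ ?_ (right_mem_Icc.2 hT)
    · refine IsClosed.inter ?_ isClosed_Icc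
      exact (hclosed.preimage cx).inter ((isClosed_le cρ continuous_const).inter
        ((isClosed_le cV continuous_const).inter (isClosed_le cg continuous_const)))
    · exact ⟨by rw [hx00]; exact hx0, by rw [hx00, hv00]; exact hρ0, le_rfl, le_rfl⟩
    · rintro t ⟨⟨hxt, hρt, hVt, hgt⟩, ht⟩ y hy
      have ht0 := ht.1
      have hρ' := (hder t ht0 hxt hρt (hVt.trans hV00.le)).2.2.1
      have e1 : ∀ᶠ s in 𝓝 t, ⟪v s, hessCLM E (x s) (v s)⟫ < 0 :=
        cρ.continuousAt.eventually_lt continuousAt_const (by linarith)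
      have e2 : ∀ᶠ s in 𝓝 t, V s < η :=
        cV.continuousAt.eventually_lt continuousAt_const (by linarith)
      have e3 : ∀ᶠ s in 𝓝 t, g s < L ^ 2 :=
        cg.continuousAt.eventually_lt continuousAt_const (by linarith)
      obtain ⟨d, hd, hd'⟩ := Metric.eventually_nhds_iff.1 (e1.and (e2.and e3))
      have hyt : t < y := hy
      set s := min y (t + d / 2) with hs
      have hts : t < s := lt_min hyt (by linarith)
      have hsd : s ≤ t + d / 2 := min_le_right _ _
      have hI : ∀ u ∈ Icc t s, ⟪v u, hessCLM E (x u) (v u)⟫ < 0 ∧ V u < η ∧ g u < L ^ 2 := by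
        intro u hu
        apply hd'
        rw [Real.dist_eq, abs_of_nonneg (by linarith [hu.1])]
        linarith [hu.2]
      have hxI : ∀ u ∈ Icc t s, x u ∈ Ω := by
        intro u hu
        obtain ⟨p, hp, hΩ⟩ := hcomp
        have h1 : IsPreconnected (x '' Icc t s) := isPreconnected_Icc.image _ cx.continuousOn
        have h2 : x '' Icc t s ⊆ {x : Vec N | ‖gradient E x‖ ≤ L} := by
          rintro _ ⟨u, hu, rfl⟩
          exact (lt_of_pow_lt_pow_left₀ 2 hL0.le (hI u hu).2.2).le
        have h3 := h1.subset_connectedComponentIn (mem_image_of_mem x (left_mem_Icc.2 hts.le)) h2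
        rw [hΩ] at hxt ⊢
        rw [connectedComponentIn_eq hxt]
        exact h3 (mem_image_of_mem x hu)
      have hD : ∀ u ∈ Icc t s, ∃ g' V', HasDerivAt g g' u ∧ HasDerivAt V V' u ∧ g' ≤ 0 ∧ V' ≤ 0 := by
        intro u hu
        obtain ⟨_, _, _, g', V', a1, a2, a3, a4⟩ := hder u (ht0.trans hu.1) (hxI u hu)
          (hI u hu).1.le (hI u hu).2.1.le
        refine ⟨g', V', a1, a2, a3, a4.trans ?_⟩
        have := mul_nonneg hγ.le (hVn u)
        linarith
      have mV : AntitoneOn V (Icc t s) := by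
        refine antitoneOn_of_deriv_nonpos (convex_Icc _ _) cV.continuousOn (fun u hu => ?_)
          (fun u hu => ?_)
        · obtain ⟨_, _, _, a2, _, _⟩ := hD u (interior_subset hu)
          exact a2.differentiableAt.differentiableWithinAt
        · obtain ⟨_, _, _, a2, _, a4⟩ := hD u (interior_subset hu)
          rw [a2.deriv]; exact a4
      have mg : AntitoneOn g (Icc t s) := by
        refine antitoneOn_of_deriv_nonpos (convex_Icc _ _) cg.continuousOn (fun u hu => ?_)
          (fun u hu => ?_)
        · obtain ⟨_, _, a2, _, _, _⟩ := hD u (interior_subset hu)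
          exact a2.differentiableAt.differentiableWithinAt
        · obtain ⟨_, _, a2, _, a4, _⟩ := hD u (interior_subset hu)
          rw [a2.deriv]; exact a4
      have hl := left_mem_Icc.2 hts.le
      have hr := right_mem_Icc.2 hts.le
      exact ⟨s, ⟨hxI s hr, (hI s hr).1.le, (mV hl hr hts.le).trans hVt,
        (mg hl hr hts.le).trans hgt⟩, hts, min_le_left _ _⟩
  refine ⟨x, v, hx00, hv00, contDiff_fst.comp hzC1, contDiff_snd.comp hzC1, fun T hT => ?_⟩
  have hall := fun t (ht : 0 ≤ t) =>
    hder t ht (hboot t ht).1 (hboot t ht).2.1 ((hboot t ht).2.2.1.trans hV00.le)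
  refine ⟨(hboot T hT).1, hv1 T hT, (hall T hT).1, (hall T hT).2.1, (hall T hT).2.2.1, ?_⟩
  have hW : ∀ t, 0 ≤ t → ∃ W', HasDerivAt (fun t => V t * Real.exp (γ * t)) W' t ∧ W' ≤ 0 := by
    intro t ht
    obtain ⟨_, _, _, _, V', _, a2, _, a4⟩ := hall t ht
    have h1 : HasDerivAt (fun u : ℝ => γ * u) γ t := by
      simpa using (hasDerivAt_id t).const_mul γ
    refine ⟨_, a2.mul h1.exp, ?_⟩
    have := Real.exp_pos (γ * t)
    nlinarith
  have mW : AntitoneOn (fun t => V t * Real.exp (γ * t)) (Ici 0) := by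
    refine antitoneOn_of_deriv_nonpos (convex_Ici _)
      (cV.mul (Real.continuous_exp.comp (continuous_const.mul continuous_id))).continuousOn
      (fun u hu => ?_) (fun u hu => ?_)
    · obtain ⟨_, a, _⟩ := hW u (interior_subset hu)
      exact a.differentiableAt.differentiableWithinAt
    · obtain ⟨_, a, b⟩ := hW u (interior_subset hu)
      rw [a.deriv]; exact b
  have h := mW (mem_Ici.2 le_rfl) (mem_Ici.2 hT) hT
  simp only [mul_zero, Real.exp_zero, mul_one] at h
  have h2 : V T ≤ η * Real.exp (-γ * T) := by
    rw [neg_mul, Real.exp_neg, ← div_eq_mul_inv, le_div_iff₀ (Real.exp_pos _)]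
    linarith
  exact h2
end Core

section Spec
variable {N : ℕ}

theorem gad_spectral (H : Vec N →L[ℝ] Vec N) (hs : ∀ u w, ⟪H u, w⟫ = ⟪u, H w⟫) (l1 l2 m : ℝ)
    (hT : TwoSmallestEigen H.toLinearMap l1 l2) (h1 : l1 < 0) (h2 : 0 < l2)
    (hlow : ∀ u, m * ‖u‖ ≤ ‖H u‖) :
    l1 ≤ -m ∧ ∀ w, ‖w‖ = 1 → H w = l1 • w → ∀ z, ⟪w, z⟫ = 0 → m * ‖z‖ ^ 2 ≤ ⟪z, H z⟫ := by
  obtain ⟨he1, he2, hle, hmin, hor, hdim⟩ := hT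
  have habs : ∀ μ : ℝ, Module.End.HasEigenvalue H.toLinearMap μ → m ≤ |μ| := by
    intro μ hμ
    obtain ⟨u, hu⟩ := hμ.exists_hasEigenvector
    have hu1 : H u = μ • u := hu.apply_eq_smul
    have hu2 : 0 < ‖u‖ := norm_pos_iff.2 hu.2
    have := hlow u
    rw [hu1, norm_smul, Real.norm_eq_abs] at this
    exact le_of_mul_le_mul_right this hu2
  have hl1 := habs _ he1
  rw [abs_of_neg h1] at hl1
  have hl2 := habs _ he2
  rw [abs_of_pos h2] at hl2
  refine ⟨by linarith, fun w hw hHw z hz => ?_⟩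
  have hsym : H.toLinearMap.IsSymmetric := fun u w => hs u w
  have hn : Module.finrank ℝ (Vec N) = N := by simp
  set b := hsym.eigenvectorBasis hn with hb
  have hbe : ∀ i, H (b i) = (hsym.eigenvalues hn i) • b i := fun i =>
    hsym.apply_eigenvectorBasis hn i
  have hw0 : w ≠ 0 := by intro h; rw [h] at hw; simp at hw
  have hcoef : ∀ i, m * ⟪b i, z⟫ ^ 2 ≤ hsym.eigenvalues hn i * ⟪b i, z⟫ ^ 2 := by
    intro i
    rcases hor _ (hsym.hasEigenvalue_eigenvalues hn i) with h | h
    · have hd := hdim (by linarith)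
      have hwm : w ∈ Module.End.eigenspace H.toLinearMap l1 := Module.End.mem_eigenspace_iff.2 hHw
      have hbm : b i ∈ Module.End.eigenspace H.toLinearMap l1 :=
        Module.End.mem_eigenspace_iff.2 (by rw [← h]; exact hbe i)
      obtain ⟨c, hc⟩ := exists_smul_eq_of_finrank_eq_one hd (x := (⟨w, hwm⟩ :
        Module.End.eigenspace H.toLinearMap l1)) (by simpa using hw0) ⟨b i, hbm⟩
      have hc' : c • w = b i := congrArg Subtype.val hc
      rw [← hc', inner_smul_left, hz]; simp
    · have : (RCLike.ofReal (hsym.eigenvalues hn i) : ℝ) = hsym.eigenvalues hn i := rfl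
      have h' : m ≤ hsym.eigenvalues hn i := hl2.trans h
      exact mul_le_mul_of_nonneg_right h' (sq_nonneg _)
  have e1 : ⟪z, H z⟫ = ∑ i, hsym.eigenvalues hn i * ⟪b i, z⟫ ^ 2 := by
    rw [← b.sum_inner_mul_inner z (H z)]
    refine Finset.sum_congr rfl fun i _ => ?_
    rw [← hs, hbe, inner_smul_left, real_inner_comm z (b i)]
    simp; ring
  have e2 : ‖z‖ ^ 2 = ∑ i, ⟪b i, z⟫ ^ 2 := by
    rw [← real_inner_self_eq_norm_sq, ← b.sum_inner_mul_inner z z]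
    refine Finset.sum_congr rfl fun i _ => ?_
    rw [real_inner_comm z (b i)]; ring
  rw [e1, e2, Finset.mul_sum]
  exact Finset.sum_le_sum fun i _ => hcoef i

end Spec

/-- (Region of attraction for the GAD.) If `Ω` is a bounded closed
connected component of `{‖∇E‖ ≤ L}` on which `λ1 < 0 < λ2`, then for `ε` and `δ0`
sufficiently small, the `ε`-GAD started at `x0 ∈ int Ω` with unit `v0` within `δ0` of
`v1(x0)` has a unique global solution converging exponentially (in both components)
to an index-1 saddle `x*` and its first eigenvector. -/
theorem stmt6 {N : ℕ} (E : Vec N → ℝ) (hE : ContDiff ℝ 3 E) (L : ℝ) (hL : 0 < L)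
    (Ω : Set (Vec N))
    (hcomp : ∃ y ∈ {x : Vec N | ‖gradient E x‖ ≤ L},
      Ω = connectedComponentIn {x : Vec N | ‖gradient E x‖ ≤ L} y)
    (hclosed : IsClosed Ω) (hbdd : Bornology.IsBounded Ω)
    (lam1 lam2 : Vec N → ℝ)
    (heig : ∀ x ∈ Ω, TwoSmallestEigen (hessOp E x) (lam1 x) (lam2 x) ∧
      lam1 x < 0 ∧ 0 < lam2 x) :
    ∃ ε0 δ0 : ℝ, 0 < ε0 ∧ 0 < δ0 ∧
      ∀ ε : ℝ, 0 < ε → ε ≤ ε0 →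
      ∀ x0 ∈ interior Ω, ∀ v0 : Vec N, ‖v0‖ = 1 →
        (∃ w : Vec N, IsMinEigvec (hessOp E x0) w ∧ ‖v0 - w‖ < δ0) →
        ∃ x v : ℝ → Vec N, x 0 = x0 ∧ v 0 = v0 ∧
          (∀ t ∈ Ici (0:ℝ), x t ∈ Ω ∧ ‖v t‖ = 1) ∧
          ContDiffOn ℝ 1 x (Ici 0) ∧ ContDiffOn ℝ 1 v (Ici 0) ∧
          IsGADSolOn E ε x v (Ici 0) ∧
          (∀ y u : ℝ → Vec N, y 0 = x0 → u 0 = v0 → IsGADSolOn E ε y u (Ici 0) →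
            ∀ t ∈ Ici (0:ℝ), y t = x t ∧ u t = v t) ∧
          ∃ xstar ∈ Ω, IsIndexOneSaddle E xstar ∧
            ∃ wstar : Vec N, IsMinEigvec (hessOp E xstar) wstar ∧
              ∃ K c : ℝ, 0 < K ∧ 0 < c ∧
                ∀ t ∈ Ici (0:ℝ),
                  ‖x t - xstar‖ + ‖v t - wstar‖ ≤ K * Real.exp (-c * t) := by
  have hcompact : IsCompact Ω := Metric.isCompact_of_isClosed_isBounded hclosed hbdd
  obtain ⟨B, hB⟩ := hbdd.exists_norm_le
  have cH : Continuous (hessCLM E) := (gad_contDiff_hess E hE).continuous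
  obtain ⟨Λ0, hΛ0⟩ := hcompact.exists_bound_of_continuousOn cH.continuousOn
  obtain ⟨C, hC⟩ := hcompact.exists_bound_of_continuousOn
    ((gad_contDiff_hess E hE).continuous_fderiv (by norm_num)).continuousOn
  obtain ⟨Λ, hΛn, hΛ⟩ : ∃ Λ : ℝ, 0 ≤ Λ ∧ ∀ x ∈ Ω, ‖hessCLM E x‖ ≤ Λ :=
    ⟨max Λ0 0, le_max_right _ _, fun x hx => (hΛ0 x hx).trans (le_max_left _ _)⟩
  have hinj : ∀ x ∈ Ω, ∀ u : Vec N, hessCLM E x u = 0 → u = 0 := by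
    intro x hx u hu
    by_contra hne
    obtain ⟨⟨_, _, _, _, hor, _⟩, h1, h2⟩ := heig x hx
    have hev : (hessOp E x).HasEigenvalue 0 :=
      Module.End.hasEigenvalue_of_hasEigenvector (x := u)
        ⟨Module.End.mem_eigenspace_iff.2 (by rw [zero_smul]; exact hu), hne⟩
    rcases hor 0 hev with h | h <;> linarith
  obtain ⟨m, hm, hlow⟩ : ∃ m : ℝ, 0 < m ∧ ∀ x ∈ Ω, ∀ u : Vec N, m * ‖u‖ ≤ ‖hessCLM E x u‖ := by
    obtain ⟨m, hm, h⟩ := (hcompact.prod (isCompact_sphere (0 : Vec N) 1)).exists_forall_le'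
      (f := fun p : Vec N × Vec N => ‖hessCLM E p.1 p.2‖) (a := 0)
      ((cH.comp continuous_fst).clm_apply continuous_snd).norm.continuousOn
      (by
        rintro ⟨x, u⟩ ⟨hx, hu⟩
        refine norm_pos_iff.2 fun h0 => ?_
        have := hinj x hx u h0
        simp [this] at hu)
    refine ⟨m, hm, fun x hx u => ?_⟩
    rcases eq_or_ne u 0 with rfl | hu
    · simp
    · have hu' : 0 < ‖u‖ := norm_pos_iff.2 hu
      have h1 := h (x, ‖u‖⁻¹ • u) ⟨hx, by simp [norm_smul, hu'.ne']⟩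
      simp only [map_smul, norm_smul, norm_inv, norm_norm] at h1
      rw [inv_mul_eq_div, le_div_iff₀ hu'] at h1
      exact h1
  set γ := m / 2 with hγ
  have hγ0 : 0 < γ := by positivity
  set η := m ^ 3 / (8 * (Λ + m)) with hη
  have hη0 : 0 < η := by positivity
  have hη1 : (Λ + m) * η ≤ m ^ 3 / 8 := by
    rw [hη]; apply le_of_eq; field_simp
  set A := η / (4 * L ^ 2) with hA
  have hA0 : 0 < A := by positivity
  have hspec := fun x (hx : x ∈ Ω) => gad_spectral (hessCLM E x) (gad_hess_symm E hE x)
    (lam1 x) (lam2 x) m (heig x hx).1 (heig x hx).2.1 (heig x hx).2.2 (hlow x hx)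
  have hgood : ∀ x ∈ Ω, ∀ v : Vec N, ‖v‖ = 1 → ⟪v, hessCLM E x v⟫ ≤ 0 →
      ‖gadVField E x v‖ ^ 2 ≤ η → ⟪v, hessCLM E x v⟫ ≤ -γ ∧
        ∀ u, ⟪v, u⟫ = 0 → γ * ‖u‖ ^ 2 ≤ ⟪u, hessCLM E x u⟫ := by
    intro x hx v hv hρ hq
    obtain ⟨u, hu⟩ := (heig x hx).1.1.exists_hasEigenvector
    have hu1 : hessCLM E x u = lam1 x • u := hu.apply_eq_smul
    have hu0 : 0 < ‖u‖ := norm_pos_iff.2 hu.2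
    have hw1 : ‖‖u‖⁻¹ • u‖ = 1 := by simp [norm_smul, hu0.ne']
    have hw2 : hessCLM E x (‖u‖⁻¹ • u) = lam1 x • (‖u‖⁻¹ • u) := by
      rw [map_smul, hu1, smul_comm]
    exact gad_linalg (hessCLM E x) (gad_hess_symm E hE x) m Λ (lam1 x) hm (hΛ x hx) _ hw1 hw2
      (hspec x hx).1 ((hspec x hx).2 _ hw1 hw2) η hη1 v hv hρ hq
  set δ0 := min m (Real.sqrt η / 4) / (2 * Λ + 1) with hδ
  have hmin : 0 < min m (Real.sqrt η / 4) := lt_min hm (by positivity)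
  have hδ0 : 0 < δ0 := by positivity
  have hδ1 : 2 * Λ * δ0 ≤ min m (Real.sqrt η / 4) := by
    rw [hδ, ← mul_div_assoc, div_le_iff₀ (by positivity)]
    nlinarith
  set ε0 := min 1 (Real.sqrt (2 * γ ^ 2 * A / (9 * C ^ 2 + 1))) with hε
  have hε0 : 0 < ε0 := lt_min one_pos (by positivity)
  refine ⟨ε0, δ0, hε0, hδ0, ?_⟩
  intro ε hεp hεle x0 hx0i v0 hv0 ⟨w, ⟨hw, lam, hlam, hTw⟩, hvw⟩
  have hx0 : x0 ∈ Ω := interior_subset hx0i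
  set k := (ε ^ 2)⁻¹ with hk
  have hε2 : 0 < ε ^ 2 := by positivity
  have hk1 : 1 ≤ k := by
    rw [hk]
    refine (one_le_inv₀ hε2).2 (pow_le_one₀ hεp.le (hεle.trans (min_le_left _ _)))
  have hk0 : 0 < k := by linarith
  have hCA : 9 * C ^ 2 ≤ 2 * γ ^ 2 * A * k := by
    have h1 : ε ^ 2 ≤ 2 * γ ^ 2 * A / (9 * C ^ 2 + 1) := by
      rw [← Real.sq_sqrt (show 0 ≤ 2 * γ ^ 2 * A / (9 * C ^ 2 + 1) by positivity)]
      exact pow_le_pow_left₀ hεp.le (hεle.trans (min_le_right _ _)) 2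
    rw [le_div_iff₀ (by positivity)] at h1
    rw [hk, ← div_eq_mul_inv, le_div_iff₀ hε2]
    nlinarith
  have hg0 : ‖gradient E x0‖ < L := by
    have hstrict : HasStrictFDerivAt (gradient E) (hessCLM E x0) x0 :=
      (gad_contDiff_gradient E hE).contDiffAt.hasStrictFDerivAt (by norm_num)
    have hker : Function.Injective (hessCLM E x0).toLinearMap :=
      (injective_iff_map_eq_zero _).2 (hinj x0 hx0)
    have hsurj : (hessCLM E x0).range = ⊤ :=
      LinearMap.range_eq_top.2 (LinearMap.injective_iff_surjective.1 hker)
    have hmap := hstrict.map_nhds_eq_of_surj hsurj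
    have hmem : Metric.closedBall (0 : Vec N) L ∈ 𝓝 (gradient E x0) := by
      rw [← hmap, Filter.mem_map]
      refine mem_of_superset (mem_interior_iff_mem_nhds.1 hx0i) fun y hy => ?_
      obtain ⟨p, _, hΩ⟩ := hcomp
      rw [hΩ] at hy
      have := connectedComponentIn_subset _ _ hy
      simpa using this
    have h2 := mem_interior_iff_mem_nhds.2 hmem
    rw [interior_closedBall _ hL.ne'] at h2
    simpa using h2
  have hlam1 : lam = lam1 x0 :=
    le_antisymm (hlam.2 _ (heig x0 hx0).1.1) ((heig x0 hx0).1.2.2.2.1 _ hlam.1)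
  have hHw : hessCLM E x0 w = lam • w := hTw
  have hlamΛ : |lam| ≤ Λ := by
    have h := (hessCLM E x0).le_opNorm w
    rw [hHw, norm_smul, hw, mul_one, mul_one, Real.norm_eq_abs] at h
    exact h.trans (hΛ x0 hx0)
  have hlamm : lam ≤ -m := by rw [hlam1]; exact (hspec x0 hx0).1
  set e := hessCLM E x0 v0 - lam • v0 with he
  have hen : ‖e‖ ≤ min m (Real.sqrt η / 4) := by
    have h1 : e = hessCLM E x0 (v0 - w) - lam • (v0 - w) := by
      rw [he, map_sub, hHw, smul_sub]; abel
    refine le_trans ?_ hδ1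
    rw [h1]
    refine (norm_sub_le _ _).trans ?_
    have h2 : ‖hessCLM E x0 (v0 - w)‖ ≤ Λ * δ0 :=
      ((hessCLM E x0).le_opNorm _).trans (mul_le_mul (hΛ x0 hx0) hvw.le (norm_nonneg _) hΛn)
    have h3 : ‖lam • (v0 - w)‖ ≤ Λ * δ0 := by
      rw [norm_smul]
      exact mul_le_mul hlamΛ hvw.le (norm_nonneg _) hΛn
    linarith
  have hve : ⟪v0, e⟫ = ⟪v0, hessCLM E x0 v0⟫ - lam := by
    rw [he, inner_sub_right, inner_smul_right, real_inner_self_eq_norm_sq, hv0]; ring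
  have hve1 : |⟪v0, e⟫| ≤ ‖e‖ := by
    have := abs_real_inner_le_norm v0 e
    rwa [hv0, one_mul] at this
  have hρ0 : ⟪v0, hessCLM E x0 v0⟫ ≤ 0 := by
    have := (le_abs_self _).trans (hve1.trans (hen.trans (min_le_left _ _)))
    linarith
  have hgad : ‖gadVField E x0 v0‖ ≤ Real.sqrt η / 2 := by
    have h1 : gadVField E x0 v0 = -e + ⟪v0, e⟫ • v0 := by
      rw [hve, he, gadVField, sub_smul]; abel
    rw [h1]
    refine (norm_add_le _ _).trans ?_
    rw [norm_neg, norm_smul, hv0, mul_one, Real.norm_eq_abs]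
    have := hen.trans (min_le_right _ _)
    linarith
  have hV0 : ‖gadVField E x0 v0‖ ^ 2 + A * ‖gradient E x0‖ ^ 2 < η := by
    have h1 : ‖gadVField E x0 v0‖ ^ 2 ≤ η / 4 := by
      refine (pow_le_pow_left₀ (norm_nonneg _) hgad 2).trans_eq ?_
      rw [div_pow, Real.sq_sqrt hη0.le]; norm_num
    have h2 : A * ‖gradient E x0‖ ^ 2 ≤ A * L ^ 2 := by gcongr
    have h3 : A * L ^ 2 = η / 4 := by rw [hA]; field_simp
    linarith
  obtain ⟨x, v, hx00, hv00, hxC, hvC, hall⟩ := gad_core E hE L Ω hcomp hclosed B hB η γ C A k hγ0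
    hA0 hk1 hCA hgood hC x0 v0 hx0 hg0 hv0 hρ0 hV0
  refine ⟨x, v, hx00, hv00, fun t ht => ⟨(hall t ht).1, (hall t ht).2.1⟩, hxC.contDiffOn,
    hvC.contDiffOn, fun t ht => ⟨(hall t ht).2.1, (hall t ht).2.2.1, (hall t ht).2.2.2.1⟩, ?_, ?_⟩
  · intro y u hy0 hu0 hyu t ht
    have h := gad_unique _ (gad_contDiff_F E hE k) (fun t => (y t, u t)) (fun t => (x t, v t))
      (fun t ht => (hyu t ht).2.1.prodMk (hyu t ht).2.2)
      (fun t ht => (hall t ht).2.2.1.prodMk (hall t ht).2.2.2.1)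
      (by simp only [hy0, hu0, hx00, hv00]) t ht
    exact ⟨congrArg Prod.fst h, congrArg Prod.snd h⟩
  · have hsq : ∀ t : ℝ, Real.exp (-γ * t) = Real.exp (-(γ / 2) * t) ^ 2 := by
      intro t; rw [← Real.exp_nat_mul]; congr 1; push_cast; ring
    have hgadt : ∀ t, 0 ≤ t → ‖gadVField E (x t) (v t)‖ ≤ Real.sqrt η * Real.exp (-(γ / 2) * t) := by
      intro t ht
      refine abs_le_of_sq_le_sq' ?_ (by positivity) |>.2
      rw [mul_pow, Real.sq_sqrt hη0.le, ← hsq]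
      have := (hall t ht).2.2.2.2.2
      have h2 : 0 ≤ A * ‖gradient E (x t)‖ ^ 2 := by positivity
      linarith
    have hgt : ∀ t, 0 ≤ t → ‖gradient E (x t)‖ ≤ Real.sqrt (η / A) * Real.exp (-(γ / 2) * t) := by
      intro t ht
      refine abs_le_of_sq_le_sq' ?_ (by positivity) |>.2
      rw [mul_pow, Real.sq_sqrt (by positivity), ← hsq, div_mul_eq_mul_div, le_div_iff₀ hA0]
      have := (hall t ht).2.2.2.2.2
      have h2 : 0 ≤ ‖gadVField E (x t) (v t)‖ ^ 2 := by positivity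
      linarith
    have hrefl : ∀ t, 0 ≤ t → ‖-(reflect (v t) (gradient E (x t)))‖ ≤
        3 * Real.sqrt (η / A) * Real.exp (-(γ / 2) * t) := by
      intro t ht
      rw [norm_neg, reflect]
      refine (norm_sub_le _ _).trans ?_
      rw [norm_smul, (hall t ht).2.1, norm_mul]
      have h1 := abs_real_inner_le_norm (v t) (gradient E (x t))
      rw [(hall t ht).2.1] at h1
      have h2 := hgt t ht
      simp only [Real.norm_eq_abs]
      rw [abs_of_pos (show (0:ℝ) < 2 by norm_num), mul_one]
      linarith
    obtain ⟨xs, hxs, hxe⟩ := gad_exp_conv x _ (3 * Real.sqrt (η / A)) (γ / 2) (by positivity)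
      (fun t ht => (hall t ht).2.2.1) hrefl
    obtain ⟨ws, hws, hwe⟩ := gad_exp_conv v _ (k * Real.sqrt η) (γ / 2) (by positivity)
      (fun t ht => (hall t ht).2.2.2.1) (fun t ht => by
        rw [norm_smul, Real.norm_of_nonneg hk0.le, mul_assoc]
        exact mul_le_mul_of_nonneg_left (hgadt t ht) hk0.le)
    have hev : ∀ᶠ t : ℝ in atTop, 0 ≤ t := eventually_ge_atTop 0
    have hxsΩ : xs ∈ Ω := hclosed.mem_of_tendsto hxs (hev.mono fun t ht => (hall t ht).1)
    have hws1 : ‖ws‖ = 1 :=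
      tendsto_nhds_unique hws.norm (tendsto_const_nhds.congr' (hev.mono fun t ht =>
        ((hall t ht).2.1).symm))
    have hHt : Tendsto (fun t => hessCLM E (x t) (v t)) atTop (𝓝 (hessCLM E xs ws)) := by
      have hc2 : Continuous (fun p : Vec N × Vec N => hessCLM E p.1 p.2) :=
        (cH.comp continuous_fst).clm_apply continuous_snd
      exact (hc2.tendsto (xs, ws)).comp (hxs.prodMk_nhds hws)
    have hρt : Tendsto (fun t => ⟪v t, hessCLM E (x t) (v t)⟫) atTop (𝓝 ⟪ws, hessCLM E xs ws⟫) :=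
      hws.inner hHt
    have hGt : Tendsto (fun t => gradient E (x t)) atTop (𝓝 (gradient E xs)) :=
      ((gad_contDiff_gradient E hE).continuous.tendsto xs).comp hxs
    have hRt : Tendsto (fun t => gadVField E (x t) (v t)) atTop (𝓝 (gadVField E xs ws)) :=
      hHt.neg.add (hρt.smul hws)
    have hexp : Tendsto (fun t => Real.exp (-(γ / 2) * t)) atTop (𝓝 0) :=
      Real.tendsto_exp_atBot.comp (tendsto_id.const_mul_atTop_of_neg (by linarith))
    have hG0 : gradient E xs = 0 := by
      refine tendsto_nhds_unique hGt (squeeze_zero_norm' (hev.mono hgt) ?_)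
      simpa using hexp.const_mul (Real.sqrt (η / A))
    have hR0 : gadVField E xs ws = 0 := by
      refine tendsto_nhds_unique hRt (squeeze_zero_norm' (hev.mono hgadt) ?_)
      simpa using hexp.const_mul (Real.sqrt η)
    have hρs : ⟪ws, hessCLM E xs ws⟫ ≤ -γ :=
      le_of_tendsto hρt (hev.mono fun t ht => (hall t ht).2.2.2.2.1)
    have hHws : hessCLM E xs ws = ⟪ws, hessCLM E xs ws⟫ • ws := by
      have h1 : -(hessCLM E xs ws) + ⟪ws, hessCLM E xs ws⟫ • ws = 0 := hR0
      rw [neg_add_eq_zero] at h1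
      exact h1
    have hws0 : ws ≠ 0 := by intro h; rw [h] at hws1; simp at hws1
    have heve : (hessOp E xs).HasEigenvalue ⟪ws, hessCLM E xs ws⟫ :=
      Module.End.hasEigenvalue_of_hasEigenvector (x := ws)
        ⟨Module.End.mem_eigenspace_iff.2 hHws, hws0⟩
    obtain ⟨htwo, h1, h2⟩ := heig xs hxsΩ
    have hρl : ⟪ws, hessCLM E xs ws⟫ = lam1 xs := by
      rcases htwo.2.2.2.2.1 _ heve with h | h
      · exact h
      · linarith
    refine ⟨xs, hxsΩ, ⟨hG0, lam1 xs, lam2 xs, htwo, h1, h2⟩, ws,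
      ⟨hws1, lam1 xs, ⟨htwo.1, htwo.2.2.2.1⟩, ?_⟩,
      3 * Real.sqrt (η / A) / (γ / 2) + k * Real.sqrt η / (γ / 2), γ / 2, by positivity,
      by positivity, fun t ht => ?_⟩
    · rw [← hρl]; exact hHws
    · rw [add_mul]
      exact add_le_add (hxe t ht) (hwe t ht)
end
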